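/- There exists a countable two-dimensional SFT X, deterministic in some direction, whose subpattern poset contains an infinite strictly descending chain: there are configurations x_0, x_1, x_2, … ∈ X with x_0 > x_1 > x_2 > ⋯ in the subpattern preorder (equivalently, the reversed ordinal −ω order-embeds into SP(X)). -/

import Mathlib

/-- Translation of a two-dimensional configuration. -/
def shift2 {S : Type*} (n : ℤ × ℤ) (x : ℤ × ℤ → S) : ℤ × ℤ → S := fun m => x (n + m)

/-- The pattern with domain `D` and content `p` occurs in `x`. -/
def occurs2 {S : Type*} (D : Finset (ℤ × ℤ)) (p : ℤ × ℤ → S) (x : ℤ × ℤ → S) : Prop :=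
  ∃ n : ℤ × ℤ, ∀ m ∈ D, x (n + m) = p m

/-- A two-dimensional subshift of finite type: the configurations in which no pattern from a
fixed finite set of forbidden finite patterns occurs. -/
def IsSFT2 {S : Type*} (X : Set (ℤ × ℤ → S)) : Prop :=
  ∃ F : Set (Finset (ℤ × ℤ) × (ℤ × ℤ → S)), F.Finite ∧
    X = {x | ∀ P ∈ F, ¬ occurs2 P.1 P.2 x}

/-- `x ≤ y` in the subpattern preorder: every finite pattern occurring in `x` occurs in `y`. -/
def patLE2 {S : Type*} (x y : ℤ × ℤ → S) : Prop :=
  ∀ (D : Finset (ℤ × ℤ)) (n : ℤ × ℤ), ∃ n' : ℤ × ℤ, ∀ m ∈ D, y (n' + m) = x (n + m)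

/-- `x < y` in the subpattern preorder. -/
def patLT2 {S : Type*} (x y : ℤ × ℤ → S) : Prop := patLE2 x y ∧ ¬ patLE2 y x

/-- `X` is southward deterministic: two configurations of `X` agreeing on the upper half-plane
`{(a,b) : b ≥ 1}` are equal. -/
def SouthDet {S : Type*} (X : Set (ℤ × ℤ → S)) : Prop :=
  ∀ x ∈ X, ∀ y ∈ X, (∀ a b : ℤ, 1 ≤ b → x (a, b) = y (a, b)) → x = y

/-- Counterclockwise rotation by 90 degrees. -/
def rot90 (v : ℤ × ℤ) : ℤ × ℤ := (-v.2, v.1)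

/-- The action of an element of `SL₂(ℤ)` on integer vectors. -/
def sl2Vec (A : Matrix.SpecialLinearGroup (Fin 2) ℤ) (v : ℤ × ℤ) : ℤ × ℤ :=
  ((A : Matrix (Fin 2) (Fin 2) ℤ) 0 0 * v.1 + (A : Matrix (Fin 2) (Fin 2) ℤ) 0 1 * v.2,
   (A : Matrix (Fin 2) (Fin 2) ℤ) 1 0 * v.1 + (A : Matrix (Fin 2) (Fin 2) ℤ) 1 1 * v.2)

/-- The action of `SL₂(ℤ)` on configurations: `A(x)_n = x_{A⁻¹ n}`. -/
def confAct {S : Type*} (A : Matrix.SpecialLinearGroup (Fin 2) ℤ) (x : ℤ × ℤ → S) :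
    ℤ × ℤ → S := fun n => x (sl2Vec A⁻¹ n)

/-- `X` is deterministic in the direction `d`: the image of `X` under the element of `SL₂(ℤ)`
taking the 90°-counterclockwise rotation of `d` to `(1,0)` is southward deterministic. -/
def DetInDir {S : Type*} (d : ℤ × ℤ) (X : Set (ℤ × ℤ → S)) : Prop :=
  ∃ A : Matrix.SpecialLinearGroup (Fin 2) ℤ,
    sl2Vec A (rot90 d) = (1, 0) ∧ SouthDet ((confAct A) '' X)

/-- `X` is deterministic in some direction. -/
def DetSomeDir {S : Type*} (X : Set (ℤ × ℤ → S)) : Prop :=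
  ∃ d : ℤ × ℤ, IsCoprime d.1 d.2 ∧ DetInDir d X

namespace WallCA

/-- Symbols: zones `al`, `be`, `ga`, the dead zone `D`, walls `W`, `V1`, `V2`, `V3`, `WS`,
and signals. -/
inductive Cell
  | al | be | ga | D | W | V1 | V2 | V3 | WS | F | Ga | Gb | S0 | S1 | T0 | T1
  | X0 | X1 | X2 | X3
  deriving DecidableEq

/-- Messages sent to the right neighbour. -/
inductive MR
  | n | F | S | T
  deriving DecidableEq

/-- Messages sent to the left neighbour. -/
inductive ML
  | n | A | B | X
  deriving DecidableEq

open Cell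

instance : Fintype Cell :=
  ⟨{al, be, ga, D, W, V1, V2, V3, WS, F, Ga, Gb, S0, S1, T0, T1, X0, X1, X2, X3},
    fun x => by cases x <;> decide⟩

instance : Fintype MR := ⟨{.n, .F, .S, .T}, fun x => by cases x <;> decide⟩

instance : Fintype ML := ⟨{.n, .A, .B, .X}, fun x => by cases x <;> decide⟩

def oR : Cell → MR
  | F | V1 | V2 => .F
  | S1 | WS => .S
  | T1 => .T
  | _ => .n

def oL : Cell → ML
  | Ga | V3 => .A
  | Gb | V2 => .B
  | X3 => .X
  | _ => .n

/-- Colour of the left side of a symbol. -/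
def cL : Cell → ℕ
  | al | V3 | F | Ga => 1
  | ga | W | V1 | WS => 2
  | D => 3
  | _ => 0

/-- Colour of the right side of a symbol. -/
def cR : Cell → ℕ
  | be | W | V3 => 0
  | al | WS | S0 | S1 => 1
  | D | X0 | X1 | X2 | X3 => 3
  | _ => 2

/-- The local rule of the partial cellular automaton. -/
def rule : MR → Cell → ML → Option Cell
  | .n, al, .n => some al
  | .S, al, .n => some S0
  | .n, al, .A => some Ga
  | .S, al, .A => some V2
  | .n, be, .n => some be
  | .n, be, .B => some Gb
  | .n, be, .X => some X0
  | .n, ga, .n => some ga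
  | .F, ga, .n => some F
  | .T, ga, .n => some T0
  | .n, W, .n | .n, V3, .n | .n, WS, .n => some W
  | .F, W, .n | .F, V3, .n | .F, WS, .n => some V3
  | .n, W, .B | .n, V3, .B | .n, WS, .B => some V1
  | .T, W, .X | .T, V3, .X | .T, WS, .X => some X0
  | .n, F, .n => some al
  | .S, F, .n => some S0
  | .n, Ga, .n => some ga
  | .S, Ga, .n => some T0
  | .n, S0, .n => some S1
  | .n, S0, .A => some T1
  | .n, S1, .n | .n, S1, .A => some be
  | .n, D, .n => some D
  | .n, V1, .n | .n, V2, .n => some WS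
  | .n, Gb, .n => some ga
  | .n, T0, .n => some T1
  | .n, T1, .n => some be
  | .n, X0, .n => some X1
  | .n, X1, .n => some X2
  | .n, X2, .n => some X3
  | .n, X3, .n => some D
  | _, _, _ => none

/-- Space-time diagrams: `y t p` is the symbol at time `t` and position `p`. -/
structure Valid (y : ℤ → ℤ → Cell) : Prop where
  step : ∀ t p, rule (oR (y t (p - 1))) (y t p) (oL (y t (p + 1))) = some (y (t + 1) p)
  col : ∀ t p, cR (y t p) = cL (y t (p + 1))

/-- The subshift: time runs southwards. -/
def shiftSpace : Set (ℤ × ℤ → Cell) := {x | Valid fun t p => x (p, -t)}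

theorem isSFT2_of_window {S : Type*} [Finite S] [Inhabited S] (W : Finset (ℤ × ℤ))
    (P : (ℤ × ℤ → S) → Prop) (hP : ∀ u v : ℤ × ℤ → S, (∀ m ∈ W, u m = v m) → P u → P v) :
    IsSFT2 {x : ℤ × ℤ → S | ∀ n, P (shift2 n x)} := by
  classical
  let ext : (W → S) → (ℤ × ℤ → S) := fun f m => if h : m ∈ W then f ⟨m, h⟩ else default
  refine ⟨Set.image (fun f => (W, ext f)) {f | ¬ P (ext f)}, (Set.toFinite _).image _, ?_⟩
  ext x
  simp only [Set.mem_ofPred_eq, Set.mem_image, forall_exists_index, and_imp]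
  constructor
  · rintro h _ f hf rfl ⟨n, hn⟩
    exact hf (hP _ _ (fun m hm => hn m hm) (h n))
  · intro h n
    by_contra hc
    refine h _ (fun m : W => x (n + m)) (fun hq => hc (hP _ _ (fun m hm => ?_) hq)) rfl ⟨n, ?_⟩
    · simp [ext, hm, shift2]
    · intro m hm
      simp [ext, hm]

theorem isSFT2_shiftSpace : IsSFT2 shiftSpace := by
  let P : (ℤ × ℤ → Cell) → Prop := fun u =>
    rule (oR (u (-1, 0))) (u (0, 0)) (oL (u (1, 0))) = some (u (0, -1)) ∧
      cR (u (0, 0)) = cL (u (1, 0))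
  have : Inhabited Cell := ⟨be⟩
  have h := isSFT2_of_window {(-1, 0), (0, 0), (1, 0), (0, -1)} P (by
    intro u v huv
    have h1 := huv (-1, 0) (by decide)
    have h2 := huv (0, 0) (by decide)
    have h3 := huv (1, 0) (by decide)
    have h4 := huv (0, -1) (by decide)
    simp only [P, h1, h2, h3, h4, imp_self])
  convert h using 1
  ext x
  constructor
  · rintro ⟨hs, hc⟩ ⟨a, b⟩
    have e1 := hs (-b) a
    have e2 := hc (-b) a
    refine ⟨?_, ?_⟩
    · convert e1 using 3 <;> simp [shift2, sub_eq_add_neg]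
      ring_nf
    · convert e2 using 3 <;> simp [shift2]
  · intro h
    refine ⟨fun t p => ?_, fun t p => ?_⟩
    · convert (h (p, -t)).1 using 3 <;> simp [shift2, sub_eq_add_neg]
      ring_nf
    · convert (h (p, -t)).2 using 3 <;> simp [shift2]

/-- A diagram is determined by any of its rows, from that row on. -/
theorem Valid.eq_of_row {y z : ℤ → ℤ → Cell} (hy : Valid y) (hz : Valid z) {t₀ : ℤ}
    (h : ∀ p, y t₀ p = z t₀ p) (t : ℤ) (ht : t₀ ≤ t) (p : ℤ) : y t p = z t p := by
  induction t, ht using Int.leInduction generalizing p with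
  | base => exact h p
  | succ t _ ih =>
    have h1 := hy.step t p
    rw [ih, ih, ih, hz.step t p] at h1
    exact (Option.some.inj h1).symm

theorem detSomeDir_shiftSpace : DetSomeDir shiftSpace := by
  refine ⟨(0, -1), isCoprime_zero_left.2 (by norm_num), 1, by simp [sl2Vec, rot90], ?_⟩
  have e : ∀ x : ℤ × ℤ → Cell, confAct 1 x = x := by
    intro x
    funext n
    simp [confAct, sl2Vec]
  rintro _ ⟨x, hx, rfl⟩ _ ⟨y, hy, rfl⟩ h
  rw [e, e] at h ⊢
  funext ⟨a, b⟩
  have hx' : Valid fun t p => x (p, -t) := hx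
  have hy' : Valid fun t p => y (p, -t) := hy
  by_cases hb : 1 ≤ b
  · exact h a b hb
  · have := hx'.eq_of_row hy' (t₀ := -1) (fun p => h p _ (by norm_num)) (-b) (by omega) a
    simpa using this

def wall : Cell → Bool
  | W | V1 | V2 | V3 | WS => true
  | _ => false

def dead : Cell → Bool
  | D | X0 | X1 | X2 | X3 => true
  | _ => false

/-- A local consequence of the rules, checked on all windows. -/
theorem Valid.loc {y : ℤ → ℤ → Cell} (hy : Valid y) {Q : Cell → Cell → Cell → Cell → Prop}
    (h : ∀ c l, cR l = cL c → ∀ r, cR c = cL r → ∀ d, rule (oR l) c (oL r) = some d → Q l c r d)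
    (t p : ℤ) : Q (y t (p - 1)) (y t p) (y t (p + 1)) (y (t + 1) p) :=
  h _ _ (by simpa using hy.col t (p - 1)) _ (hy.col t p) _ (hy.step t p)

theorem Valid.loc_prev {y : ℤ → ℤ → Cell} (hy : Valid y) {Q : Cell → Cell → Cell → Cell → Prop}
    (h : ∀ c l, cR l = cL c → ∀ r, cR c = cL r → ∀ d, rule (oR l) c (oL r) = some d → Q l c r d)
    (t p : ℤ) : Q (y (t - 1) (p - 1)) (y (t - 1) p) (y (t - 1) (p + 1)) (y t p) := by
  simpa using hy.loc h (t - 1) p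

section Local

variable {y : ℤ → ℤ → Cell} (hy : Valid y) {t p : ℤ}
include hy

theorem Valid.wall_next (h : wall (y t p)) : wall (y (t + 1) p) ∨ dead (y (t + 1) p) :=
  hy.loc (Q := fun _ c _ d => wall c → wall d ∨ dead d) (by decide +kernel) t p h

theorem Valid.dead_next (h : dead (y t p)) : dead (y (t + 1) p) :=
  hy.loc (Q := fun _ c _ d => dead c → dead d) (by decide +kernel) t p h

theorem Valid.dead_right (h : dead (y t p)) : y t (p + 1) = D :=
  hy.loc (Q := fun _ c r _ => dead c → r = D) (by decide +kernel) t p h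

set_option synthInstance.maxSize 1000 in
theorem Valid.wall_prev (h : wall (y t p)) : wall (y (t - 1) p) ∨ y t p = V2 :=
  hy.loc_prev (Q := fun _ c _ d => wall d → wall c ∨ d = V2) (by decide +kernel) t p h

theorem Valid.V2_prev (h : y t p = V2) : y (t - 1) p = al ∧
    (y (t - 1) (p - 1) = S1 ∨ y (t - 1) (p - 1) = WS) ∧
    (y (t - 1) (p + 1) = Ga ∨ y (t - 1) (p + 1) = V3) :=
  hy.loc_prev (Q := fun l c r d => d = V2 → c = al ∧ (l = S1 ∨ l = WS) ∧ (r = Ga ∨ r = V3))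
    (by decide +kernel) t p h

theorem Valid.WS_prev (h : y t p = WS) : y (t - 1) p = V1 ∨ y (t - 1) p = V2 :=
  hy.loc_prev (Q := fun _ c _ d => d = WS → c = V1 ∨ c = V2) (by decide +kernel) t p h

theorem Valid.V_next (h : y t p = V1 ∨ y t p = V2) : y (t + 1) p = WS :=
  hy.loc (Q := fun _ c _ d => c = V1 ∨ c = V2 → d = WS) (by decide +kernel) t p h

theorem Valid.V1_prev (h : y t p = V1) : wall (y (t - 1) p) ∧
    (y (t - 1) (p + 1) = Gb ∨ y (t - 1) (p + 1) = V2) :=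
  hy.loc_prev (Q := fun _ c r d => d = V1 → wall c ∧ (r = Gb ∨ r = V2))
    (by decide +kernel) t p h

theorem Valid.V3_prev (h : y t p = V3) : wall (y (t - 1) p) ∧
    (y (t - 1) (p - 1) = F ∨ y (t - 1) (p - 1) = V1 ∨ y (t - 1) (p - 1) = V2) :=
  hy.loc_prev (Q := fun l c _ d => d = V3 → wall c ∧ (l = F ∨ l = V1 ∨ l = V2))
    (by decide +kernel) t p h

theorem Valid.F_prev (h : y t p = F) :
    y (t - 1) (p - 1) = F ∨ y (t - 1) (p - 1) = V1 ∨ y (t - 1) (p - 1) = V2 :=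
  hy.loc_prev (Q := fun l _ _ d => d = F → l = F ∨ l = V1 ∨ l = V2) (by decide +kernel) t p h

theorem Valid.Ga_prev (h : y t p = Ga) : y (t - 1) (p + 1) = Ga ∨ y (t - 1) (p + 1) = V3 :=
  hy.loc_prev (Q := fun _ _ r d => d = Ga → r = Ga ∨ r = V3) (by decide +kernel) t p h

theorem Valid.Gb_prev (h : y t p = Gb) : y (t - 1) (p + 1) = Gb ∨ y (t - 1) (p + 1) = V2 :=
  hy.loc_prev (Q := fun _ _ r d => d = Gb → r = Gb ∨ r = V2) (by decide +kernel) t p h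

/-- The left-moving signal `Gb` continues up to the next wall. -/
theorem Valid.Gb_next (h : y t p = Gb ∨ y t p = V2) :
    y (t + 1) (p - 1) = Gb ∨ wall (y t (p - 1)) ∧ y (t + 1) (p - 1) = V1 := by
  have := hy.loc (Q := fun _ c r d => r = Gb ∨ r = V2 → d = Gb ∨ (wall c ∧ d = V1) ∨ d = V1 ∧ wall c)
    (by decide +kernel) t (p - 1)
  simp only [sub_add_cancel] at this
  tauto

theorem Valid.S0_prev (h : y t p = S0) : y (t - 1) (p - 1) = S1 ∨ y (t - 1) (p - 1) = WS :=
  hy.loc_prev (Q := fun l _ _ d => d = S0 → l = S1 ∨ l = WS) (by decide +kernel) t p h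

theorem Valid.S1_prev (h : y t p = S1) : y (t - 1) p = S0 :=
  hy.loc_prev (Q := fun _ c _ d => d = S1 → c = S0) (by decide +kernel) t p h

theorem Valid.T0_prev (h : y t p = T0) :
    y (t - 1) (p - 1) = T1 ∨ y (t - 1) (p - 1) = S1 ∨ y (t - 1) (p - 1) = WS :=
  hy.loc_prev (Q := fun l _ _ d => d = T0 → l = T1 ∨ l = S1 ∨ l = WS) (by decide +kernel) t p h

theorem Valid.T1_prev (h : y t p = T1) : y (t - 1) p = T0 ∨ y (t - 1) p = S0 :=
  hy.loc_prev (Q := fun _ c _ d => d = T1 → c = T0 ∨ c = S0) (by decide +kernel) t p h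

/-- Every right-moving slow signal continues, makes a wall, or dies together with a wall. -/
theorem Valid.ST_next (h : y t p = S1 ∨ y t p = WS ∨ y t p = T1) :
    y (t + 1) (p + 1) = S0 ∨ y (t + 1) (p + 1) = T0 ∨ y (t + 1) (p + 1) = V2 ∨
      dead (y (t + 1) (p + 1)) := by
  have := hy.loc (Q := fun l _ _ d => l = S1 ∨ l = WS ∨ l = T1 → d = S0 ∨ d = T0 ∨ d = V2 ∨ dead d)
    (by decide +kernel) t (p + 1)
  simp only [add_sub_cancel_right] at this
  exact this h

theorem Valid.ST0_next (h : y t p = S0 ∨ y t p = T0) : y (t + 1) p = S1 ∨ y (t + 1) p = T1 :=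
  hy.loc (Q := fun _ c _ d => c = S0 ∨ c = T0 → d = S1 ∨ d = T1) (by decide +kernel) t p h

theorem Valid.X0_prev (h : y t p = X0) : y (t - 1) (p + 1) = X3 ∧ ¬ dead (y (t - 1) p) :=
  hy.loc_prev (Q := fun _ c r d => d = X0 → r = X3 ∧ ¬ dead c) (by decide +kernel) t p h

theorem Valid.X1_prev (h : y t p = X1) : y (t - 1) p = X0 :=
  hy.loc_prev (Q := fun _ c _ d => d = X1 → c = X0) (by decide +kernel) t p h

theorem Valid.X2_prev (h : y t p = X2) : y (t - 1) p = X1 :=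
  hy.loc_prev (Q := fun _ c _ d => d = X2 → c = X1) (by decide +kernel) t p h

theorem Valid.X3_prev (h : y t p = X3) : y (t - 1) p = X2 :=
  hy.loc_prev (Q := fun _ c _ d => d = X3 → c = X2) (by decide +kernel) t p h

theorem Valid.D_prev (h : y t p = D) : y (t - 1) p = D ∨ y (t - 1) p = X3 :=
  hy.loc_prev (Q := fun _ c _ d => d = D → c = D ∨ c = X3) (by decide +kernel) t p h

theorem Valid.X0_next (h : y t p = X0) : y (t + 1) p = X1 :=
  hy.loc (Q := fun _ c _ d => c = X0 → d = X1) (by decide +kernel) t p h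

theorem Valid.X1_next (h : y t p = X1) : y (t + 1) p = X2 :=
  hy.loc (Q := fun _ c _ d => c = X1 → d = X2) (by decide +kernel) t p h

theorem Valid.X2_next (h : y t p = X2) : y (t + 1) p = X3 :=
  hy.loc (Q := fun _ c _ d => c = X2 → d = X3) (by decide +kernel) t p h

theorem Valid.X3_next (h : y t p = X3) : y (t + 1) p = D ∧ y (t + 1) (p - 1) = X0 := by
  refine ⟨hy.loc (Q := fun _ c _ d => c = X3 → d = D) (by decide +kernel) t p h, ?_⟩
  have := hy.loc (Q := fun _ _ r d => r = X3 → d = X0) (by decide +kernel) t (p - 1)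
  simp only [sub_add_cancel] at this
  exact this h

/-- Colours do not decrease along a stretch without walls. -/
theorem Valid.rank {q : ℤ} (hpq : p < q) (h : ∀ r, p < r → r < q → ¬ wall (y t r)) :
    cR (y t p) ≤ cL (y t q) := by
  have key : ∀ n : ℕ, (p + n + 1 ≤ q) → cR (y t p) ≤ cL (y t (p + n + 1)) := by
    intro n
    induction n with
    | zero => intro _; simp [hy.col t p]
    | succ n ih =>
      intro hn
      push_cast at hn
      have h1 := ih (by omega)
      have h2 := h (p + n + 1) (by omega) (by omega)
      have h3 : ∀ c, ¬ wall c → cL c ≤ cR c := by decide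
      have h4 := hy.col t (p + n + 1)
      push_cast
      rw [show p + (n + 1 : ℤ) + 1 = p + n + 1 + 1 by ring, ← h4]
      exact h1.trans (h3 _ h2)
  have := key (q - p - 1).toNat (by omega)
  rwa [show p + ((q - p - 1).toNat : ℤ) + 1 = q by omega] at this

theorem Valid.exists_wall {q : ℤ} (hpq : p < q) (h : cL (y t q) < cR (y t p)) :
    ∃ r, p < r ∧ r < q ∧ wall (y t r) := by
  by_contra! hc
  exact absurd (hy.rank hpq hc) (by omega)

theorem Valid.dead_of_le {q : ℤ} (hpq : p ≤ q) (h : dead (y t p)) : dead (y t q) := by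
  induction q, hpq using Int.leInduction with
  | base => exact h
  | succ q _ ih => rw [hy.dead_right ih]; rfl

theorem Valid.dead_of_time_le {s : ℤ} (hts : t ≤ s) (h : dead (y t p)) : dead (y s p) := by
  induction s, hts using Int.leInduction with
  | base => exact h
  | succ s _ ih => exact hy.dead_next ih

theorem Valid.wall_of_time_le {s : ℤ} (hts : t ≤ s) (h : wall (y t p)) :
    wall (y s p) ∨ dead (y s p) := by
  induction s, hts using Int.leInduction with
  | base => exact .inl h
  | succ s _ ih =>
    rcases ih with ih | ih
    · exact hy.wall_next ih
    · exact .inr (hy.dead_next ih)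

theorem Valid.not_wall_of_time_le {s : ℤ} (hts : t ≤ s) (h1 : ¬ wall (y s p))
    (h2 : ¬ dead (y s p)) : ¬ wall (y t p) := fun h => by
  have := hy.wall_of_time_le hts h
  tauto

/-- If something of nonzero colour is followed by a dead cell, there is a wall in between. -/
theorem Valid.exists_wall_of_dead {q : ℤ} (hpq : p < q) (h0 : ¬ dead (y t p)) (h : 0 < cR (y t p))
    (hq : dead (y t q)) : ∃ r, p < r ∧ r < q ∧ wall (y t r) := by
  obtain ⟨m, ⟨hm, hm'⟩, hmin⟩ := Int.exists_least_of_bdd (P := fun r => p < r ∧ dead (y t r))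
    ⟨p, fun z hz => hz.1.le⟩ ⟨q, hpq, hq⟩
  have hmq : m ≤ q := hmin q ⟨hpq, hq⟩
  have hm1 : ¬ dead (y t (m - 1)) := fun hd => by
    by_cases h1 : p < m - 1
    · have := hmin _ ⟨h1, hd⟩
      omega
    · exact h0 (by rwa [show m - 1 = p by omega] at hd)
  have hc := hy.col t (m - 1)
  rw [sub_add_cancel] at hc
  have h3 : ∀ c d, ¬ dead c → dead d → cR c = cL d → cL d = 0 := by decide
  have h4 := h3 _ _ hm1 hm' hc
  obtain ⟨r, h5, h6, h7⟩ := hy.exists_wall hm (by omega : cL (y t m) < cR (y t p))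
  exact ⟨r, h5, by omega, h7⟩

end Local

/-- A wall that is just starting its own binary interval, together with the next wall. -/
def Start (y : ℤ → ℤ → Cell) (t a c : ℤ) : Prop :=
  (y t a = V1 ∨ y t a = V2) ∧ a < c ∧ wall (y t c) ∧ ∀ b, a < b → b < c → ¬ wall (y t b)

theorem exists_first_wall {u : ℤ → Cell} {a c : ℤ} (hac : a < c) (hc : wall (u c)) :
    ∃ c', a < c' ∧ c' ≤ c ∧ wall (u c') ∧ ∀ b, a < b → b < c' → ¬ wall (u b) := by
  obtain ⟨m, ⟨hm, hm'⟩, hmin⟩ := Int.exists_least_of_bdd (P := fun r => a < r ∧ wall (u r))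
    ⟨a, fun z hz => hz.1.le⟩ ⟨c, hac, hc⟩
  refine ⟨m, hm, hmin _ ⟨hac, hc⟩, hm', fun b h1 h2 h3 => ?_⟩
  have := hmin _ ⟨h1, h3⟩
  omega

theorem exists_start {y : ℤ → ℤ → Cell} {t a c : ℤ} (ha : y t a = V1 ∨ y t a = V2) (hac : a < c)
    (hc : wall (y t c)) : ∃ c', c' ≤ c ∧ Start y t a c' := by
  obtain ⟨c', h1, h2, h3, h4⟩ := exists_first_wall hac hc
  exact ⟨c', h2, ha, h1, h3, h4⟩

section Walls

variable {y : ℤ → ℤ → Cell} (hy : Valid y)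
include hy

/-- The first wall to the right of a cell of nonzero right colour is not new. -/
theorem Valid.wall_prev_right {t b c : ℤ} (hb : 0 < cR (y t b)) (hbc : b < c)
    (hc : wall (y t c)) (h : ∀ r, b < r → r < c → ¬ wall (y t r)) : wall (y (t - 1) c) := by
  rcases hy.wall_prev hc with h1 | h1
  · exact h1
  · have := hy.rank hbc h
    rw [h1] at this
    simp only [cL] at this
    omega

theorem Valid.exists_V1_of_Gb {a : ℤ} (n : ℕ) {t b : ℤ} (hb : y t b = Gb ∨ y t b = V2)
    (ha : wall (y t a)) (hab : a < b) (hn : b - a ≤ n) :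
    ∃ t' a', t ≤ t' ∧ a ≤ a' ∧ a' < b ∧ y t' a' = V1 := by
  induction n generalizing t b with
  | zero => omega
  | succ n ih =>
    rcases hy.Gb_next hb with h | ⟨-, h⟩
    · have hw : wall (y (t + 1) a) := by
        rcases hy.wall_next ha with h1 | h1
        · exact h1
        · have := hy.dead_of_le (show a ≤ b - 1 by omega) h1
          rw [h] at this
          cases this
      have hne : a ≠ b - 1 := by
        rintro rfl
        rw [h] at hw
        cases hw
      push_cast at hn
      obtain ⟨t', a', h1, h2, h3, h4⟩ := ih (.inl h) hw (by omega) (by omega)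
      exact ⟨t', a', by omega, h2, by omega, h4⟩
    · exact ⟨t + 1, b - 1, by omega, by omega, by omega, h⟩

theorem Valid.exists_start_of_Gb {t a b c : ℤ} (hb : y t b = Gb ∨ y t b = V2)
    (ha : wall (y t a)) (hab : a < b) (hbc : b ≤ c) (hc : wall (y t c)) :
    ∃ t' a' c', a ≤ a' ∧ Start y t' a' c' := by
  obtain ⟨t', a', h1, h2, h3, h4⟩ :=
    hy.exists_V1_of_Gb (b - a).toNat hb ha hab (by omega)
  have hw : ∃ r, a' < r ∧ wall (y t' r) := by
    rcases hy.wall_of_time_le h1 hc with h5 | h5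
    · exact ⟨c, by omega, h5⟩
    · obtain ⟨r, h6, -, h7⟩ := hy.exists_wall_of_dead (t := t') (show a' < c by omega)
        (by rw [h4]; decide) (by rw [h4]; decide) h5
      exact ⟨r, h6, h7⟩
  obtain ⟨r, h6, h7⟩ := hw
  obtain ⟨c', -, h8⟩ := exists_start (.inl h4) h6 h7
  exact ⟨t', a', c', h2, h8⟩

theorem Valid.exists_start_of_WS {t a c : ℤ} (ha : y t a = WS) (hac : a < c)
    (hc : wall (y t c)) : ∃ c', c' ≤ c ∧ Start y (t - 1) a c' := by
  obtain ⟨c', h1, h2, h3, h4⟩ := exists_first_wall hac hc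
  obtain ⟨c'', h5, h6⟩ := exists_start (hy.WS_prev ha) h1
    (hy.wall_prev_right (by rw [ha]; decide) h1 h3 h4)
  exact ⟨c'', by omega, h6⟩

def slow : Cell → Bool
  | S0 | S1 | T0 | T1 => true
  | _ => false

theorem Valid.exists_start_of_slow {a : ℤ} (n : ℕ) {t b c : ℤ} (hb : slow (y t b))
    (ha : wall (y t a)) (hab : a < b) (hbc : b < c) (hc : wall (y t c))
    (hn : 2 * (b - a) + (if y t b = S1 ∨ y t b = T1 then 1 else 0) ≤ n) :
    ∃ t' a' c', a ≤ a' ∧ Start y t' a' c' := by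
  induction n generalizing t b c with
  | zero => split_ifs at hn <;> omega
  | succ n ih =>
    rcases hy.wall_prev ha with ha' | ha'
    swap
    · obtain ⟨c', -, h⟩ := exists_start (.inr ha') (hab.trans hbc) hc
      exact ⟨t, a, c', le_rfl, h⟩
    obtain ⟨c', h1, h2, h3, h4⟩ := exists_first_wall hbc hc
    have hR : ∀ x, slow x → 0 < cR x := by decide
    have hc' := hy.wall_prev_right (hR _ hb) h1 h3 h4
    have left : y (t - 1) (b - 1) = T1 ∨ y (t - 1) (b - 1) = S1 ∨ y (t - 1) (b - 1) = WS →
        2 * (b - a) ≤ n + 1 → ∃ t' a' c', a ≤ a' ∧ Start y t' a' c' := by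
      intro h hn'
      rcases h with h | h | h
      · have hne : a ≠ b - 1 := by
          rintro rfl
          rw [h] at ha'
          cases ha'
        exact ih (b := b - 1) (by rw [h]; rfl) ha' (by omega) (by omega) hc'
          (by split_ifs <;> omega)
      · have hne : a ≠ b - 1 := by
          rintro rfl
          rw [h] at ha'
          cases ha'
        exact ih (b := b - 1) (by rw [h]; rfl) ha' (by omega) (by omega) hc'
          (by split_ifs <;> omega)
      · obtain ⟨c'', -, h5⟩ := hy.exists_start_of_WS h (show b - 1 < c' by omega) hc'
        exact ⟨_, b - 1, c'', by omega, h5⟩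
    have stay : y (t - 1) b = S0 ∨ y (t - 1) b = T0 → 2 * (b - a) ≤ n →
        ∃ t' a' c', a ≤ a' ∧ Start y t' a' c' := by
      intro h hn'
      refine ih (b := b) ?_ ha' hab h1 hc' ?_
      · rcases h with h | h <;> rw [h] <;> rfl
      · rcases h with h | h <;> rw [h] <;> simpa using hn'
    have hs : ∀ x, slow x → x = S0 ∨ x = S1 ∨ x = T0 ∨ x = T1 := by decide
    push_cast at hn
    rcases hs _ hb with h | h | h | h 
    · exact left (.inr (hy.S0_prev h)) (by split_ifs at hn <;> omega)
    · exact stay (.inl (hy.S1_prev h)) (by simp only [h, true_or, if_true] at hn; omega)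
    · exact left (hy.T0_prev h) (by split_ifs at hn <;> omega)
    · exact stay (hy.T1_prev h).symm (by simp only [h, or_true, if_true] at hn; omega)

theorem Valid.exists_rise {t a c : ℤ} (hac : a < c) (h0 : cR (y t a) = 0) (hc : 0 < cL (y t c)) :
    ∃ b, a < b ∧ b < c ∧ cL (y t b) = 0 ∧ 0 < cR (y t b) := by
  obtain ⟨m, ⟨hm, hm'⟩, hmin⟩ := Int.exists_least_of_bdd (P := fun r => a < r ∧ 0 < cL (y t r))
    ⟨a, fun z hz => hz.1.le⟩ ⟨c, hac, hc⟩
  have hmc := hmin _ ⟨hac, hc⟩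
  have hcol := hy.col t (m - 1)
  rw [sub_add_cancel] at hcol
  have h1 : a < m - 1 := by
    by_contra h
    have : m - 1 = a := by omega
    rw [this, h0] at hcol
    omega
  refine ⟨m - 1, h1, by omega, ?_, by omega⟩
  by_contra h
  have := hmin _ ⟨h1, Nat.pos_of_ne_zero h⟩
  omega

/-- Two walls in the same row force a start. -/
theorem Valid.exists_start_of_two_walls {t a c : ℤ} (hac : a < c) (ha : wall (y t a))
    (hc : wall (y t c)) : ∃ t' a' c', a ≤ a' ∧ Start y t' a' c' := by
  obtain ⟨c, hac, -, hc, hb⟩ := exists_first_wall hac hc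
  have hw : ∀ x, wall x → (x = V1 ∨ x = V2) ∨ x = WS ∨ cR x = 0 := by decide
  rcases hw _ ha with h | h | h
  · obtain ⟨c', -, h1⟩ := exists_start h hac hc
    exact ⟨t, a, c', le_rfl, h1⟩
  · obtain ⟨c', -, h1⟩ := hy.exists_start_of_WS h hac hc
    exact ⟨_, a, c', le_rfl, h1⟩
  · have hcw : ∀ x, wall x → x = V2 ∨ 0 < cL x := by decide
    rcases hcw _ hc with h2 | h2
    · exact hy.exists_start_of_Gb (.inr h2) ha hac le_rfl hc
    · obtain ⟨b, h3, h4, h5, h6⟩ := hy.exists_rise hac h h2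
      have hc3 : ∀ x, wall x → cL x < 3 := by decide
      have h8 := hy.rank (t := t) h4 (fun r h1 h2 => hb r (by omega) h2)
      have hx : ∀ x, cL x = 0 → 0 < cR x → cR x < 3 → ¬ wall x → x = Gb ∨ slow x := by decide
      rcases hx _ h5 h6 (h8.trans_lt (hc3 _ hc)) (hb b h3 h4) with h9 | h9
      · exact hy.exists_start_of_Gb (.inl h9) ha h3 h4.le hc
      · exact hy.exists_start_of_slow (2 * (b - a) + 1).toNat h9 ha h3 h4 hc
          (by split_ifs <;> omega)

end Walls

section Triangle

variable {y : ℤ → ℤ → Cell} (hy : Valid y)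
include hy

/-- No walls in the triangle swept by the signals that made the wall `V2`. -/
theorem Valid.triangle_not_wall {t b i K d q : ℤ} (hV : y t b = V2)
    (hGa : ∀ d, 1 ≤ d → d < i → y (t - d) (b + d) = Ga)
    (hS : ∀ j, 1 ≤ j → j < K → y (t - (2 * j - 1)) (b - j) = S1)
    (hd : 1 ≤ d) (hq : b - K < q) (hqi : q < b + i) (h1 : q - b ≤ d) (h2 : 2 * (b - q) - 1 ≤ d) :
    ¬ wall (y (t - d) q) := by
  rcases lt_trichotomy q b with h | rfl | h
  · have := hS (b - q) (by omega) (by omega)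
    rw [sub_sub_cancel] at this
    exact hy.not_wall_of_time_le (s := t - (2 * (b - q) - 1)) (by omega) (by rw [this]; decide)
      (by rw [this]; decide)
  · have := (hy.V2_prev hV).1
    exact hy.not_wall_of_time_le (s := t - 1) (by omega) (by rw [this]; decide)
      (by rw [this]; decide)
  · have := hGa (q - b) (by omega) (by omega)
    rw [add_sub_cancel] at this
    exact hy.not_wall_of_time_le (s := t - (q - b)) (by omega) (by rw [this]; decide)
      (by rw [this]; decide)

theorem Valid.triangle_aux {t b i : ℤ} (hi : 1 ≤ i) (hV : y t b = V2)
    (hGa : ∀ d, 1 ≤ d → d < i → y (t - d) (b + d) = Ga) {k : ℤ} (hk : 1 ≤ k)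
    (hki : k ≤ 2 * i) (h3 : y (t - i) (b + i) = V3 ∨ 2 * k - 1 < i) :
    (∀ j, 1 ≤ j → j < k → y (t - (2 * j - 1)) (b - j) = S1 ∧ y (t - 2 * j) (b - j) = S0) ∧
    (y (t - (2 * k - 1)) (b - k) = S1 ∨ y (t - (2 * k - 1)) (b - k) = WS) ∧
    ∀ d, i < d → d ≤ 2 * k - 1 → y (t - d) (b + 2 * i - d) = F := by
  induction k, hk using Int.leInduction with
  | base =>
    refine ⟨fun j h1 h2 => by omega, ?_, fun d h1 h2 => by omega⟩
    simpa using (hy.V2_prev hV).2.1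
  | succ k hk ih =>
    obtain ⟨hS, hW, hF⟩ := ih (by omega) (h3.imp_right (by omega))
    have nextF : ∀ K d, (∀ j, 1 ≤ j → j < K → y (t - (2 * j - 1)) (b - j) = S1) → i < d →
        b - K < b + 2 * i - d → 2 * (d - 2 * i) - 1 ≤ d →
        (i < d - 1 → y (t - (d - 1)) (b + 2 * i - (d - 1)) = F) →
        y (t - i) (b + i) = V3 → y (t - d) (b + 2 * i - d) = F := by
      intro K d hK hid h1 h2 hF' hV3
      have hn := hy.triangle_not_wall (q := b + 2 * i - d) hV hGa hK (by omega : 1 ≤ d) h1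
        (by omega) (by omega) (by omega)
      have hp : y (t - d) (b + 2 * i - d) = F ∨ y (t - d) (b + 2 * i - d) = V1 ∨
          y (t - d) (b + 2 * i - d) = V2 := by
        by_cases hid' : i < d - 1
        · have := hy.F_prev (hF' hid')
          rwa [show t - (d - 1) - 1 = t - d by ring,
            show b + 2 * i - (d - 1) - 1 = b + 2 * i - d by ring] at this
        · have := (hy.V3_prev hV3).2
          rwa [show t - i - 1 = t - d by omega,
            show b + i - 1 = b + 2 * i - d by omega] at this
      rcases hp with h | h | h
      · exact h
      · rw [h] at hn
        exact absurd rfl hn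
      · rw [h] at hn
        exact absurd rfl hn
    have hF1 : i < 2 * k → y (t - 2 * k) (b + 2 * i - 2 * k) = F := fun h =>
      nextF k _ (fun j h1 h2 => (hS j h1 h2).1) h (by omega) (by omega)
        (fun h' => hF _ h' (by omega)) (h3.resolve_right (by omega))
    have hS1 : y (t - (2 * k - 1)) (b - k) = S1 := by
      rcases hW with h | h
      · exact h
      exfalso
      have hV' := hy.WS_prev h
      rw [show t - (2 * k - 1) - 1 = t - 2 * k by ring] at hV'
      have hr : ∃ r, b - k < r ∧ r ≤ b + i ∧ r ≤ b + 2 * k ∧ cL (y (t - 2 * k) r) = 1 := by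
        rcases lt_trichotomy (2 * k) i with h1 | h1 | h1
        · exact ⟨b + 2 * k, by omega, by omega, by omega, by rw [hGa _ (by omega) h1]; rfl⟩
        · refine ⟨b + i, by omega, by omega, by omega, ?_⟩
          rw [h1, h3.resolve_right (by omega)]
          rfl
        · exact ⟨b + 2 * i - 2 * k, by omega, by omega, by omega, by rw [hF1 h1]; rfl⟩
      obtain ⟨r, h1, h2, h2', h4⟩ := hr
      have := hy.rank h1 (fun q h5 h6 => hy.triangle_not_wall (K := k) hV hGa
        (fun j h1 h2 => (hS j h1 h2).1) (by omega : 1 ≤ 2 * k) h5 (by omega) (by omega)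
        (by omega))
      rw [h4] at this
      rcases hV' with h7 | h7 <;> rw [h7] at this <;> simp [cR] at this
    have hS0 : y (t - 2 * k) (b - k) = S0 := by
      have := hy.S1_prev hS1
      rwa [show t - (2 * k - 1) - 1 = t - 2 * k by ring] at this
    have hSk : ∀ j, 1 ≤ j → j < k + 1 →
        y (t - (2 * j - 1)) (b - j) = S1 ∧ y (t - 2 * j) (b - j) = S0 := by
      intro j h1 h2
      rcases (show j < k ∨ j = k by omega) with h | rfl
      · exact hS j h1 h
      · exact ⟨hS1, hS0⟩
    refine ⟨hSk, ?_, fun d h1 h2 => ?_⟩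
    · have := hy.S0_prev hS0
      rwa [show t - 2 * k - 1 = t - (2 * (k + 1) - 1) by ring,
        show b - k - 1 = b - (k + 1) by ring] at this
    · rcases (show d ≤ 2 * k - 1 ∨ d = 2 * k ∨ d = 2 * k + 1 by omega) with h | rfl | rfl
      · exact hF d h1 h
      · exact hF1 h1
      · exact nextF (k + 1) _ (fun j h1 h2 => (hSk j h1 h2).1) h1 (by omega) (by omega)
          (fun h' => by simpa using hF1 (by omega)) (h3.resolve_right (by omega))

/-- The wall `V2` is made by signals from a starting wall, one of them reflected at `V3`. -/
theorem Valid.start_of_triangle {t b i : ℤ} (hi : 1 ≤ i) (hV : y t b = V2)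
    (hGa : ∀ d, 1 ≤ d → d < i → y (t - d) (b + d) = Ga) (h3 : y (t - i) (b + i) = V3) :
    Start y (t - 4 * i) (b - 2 * i) (b + i) := by
  obtain ⟨hS, hW, hF⟩ := hy.triangle_aux hi hV hGa (show 1 ≤ 2 * i by omega) le_rfl (.inl h3)
  have nw : ∀ d q, 1 ≤ d → b - 2 * i < q → q < b + i → q - b ≤ d → 2 * (b - q) - 1 ≤ d →
      ¬ wall (y (t - d) q) := fun d q h1 h2 h4 h5 h6 =>
    hy.triangle_not_wall hV hGa (fun j h1 h2 => (hS j h1 h2).1) h1 h2 h4 h5 h6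
  have hp : y (t - 4 * i) (b - 2 * i) = F ∨ y (t - 4 * i) (b - 2 * i) = V1 ∨
      y (t - 4 * i) (b - 2 * i) = V2 := by
    by_cases h : i < 4 * i - 1
    · have := hy.F_prev (hF (4 * i - 1) h (by omega))
      rwa [show t - (4 * i - 1) - 1 = t - 4 * i by ring,
        show b + 2 * i - (4 * i - 1) - 1 = b - 2 * i by ring] at this
    · omega
  have hWS : y (t - (2 * (2 * i) - 1)) (b - 2 * i) = WS := by
    refine hW.resolve_left fun h => ?_
    have := hy.S1_prev h
    rw [show t - (2 * (2 * i) - 1) - 1 = t - 4 * i by ring] at this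
    rw [this] at hp
    simp at hp
  have hV12 := hy.WS_prev hWS
  rw [show t - (2 * (2 * i) - 1) - 1 = t - 4 * i by ring] at hV12
  have hw : ∀ d, i ≤ d → d ≤ 4 * i → wall (y (t - d) (b + i)) := by
    intro d hd
    induction d, hd using Int.leInduction with
    | base => intro _; rw [h3]; rfl
    | succ d hd ih =>
      intro hd'
      have h := ih (by omega)
      rw [← sub_sub]
      refine (hy.wall_prev h).resolve_right fun h2 => ?_
      rcases hd.eq_or_lt with rfl | hd
      · rw [h2] at h3
        cases h3
      have h4 := hy.rank (t := t - d) (p := b + 2 * i - d) (q := b + i) (by omega)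
        (fun r h5 h6 => nw d r (by omega) (by omega) h6 (by omega) (by omega))
      rw [h2, hF d hd (by omega)] at h4
      simp [cL, cR] at h4
  exact ⟨hV12, by omega, hw _ (by omega) le_rfl,
    fun q h1 h2 => nw _ q (by omega) h1 h2 (by omega) (by omega)⟩

end Triangle

section Chain

variable {y : ℤ → ℤ → Cell} (hy : Valid y)
include hy

theorem Valid.start_not_wall {t a c : ℤ} (h : Start y t a c) {s q : ℤ} (hs : s ≤ t) (haq : a < q)
    (hqc : q < c) : ¬ wall (y s q) := by
  refine hy.not_wall_of_time_le hs (h.2.2.2 q haq hqc) fun hd => ?_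
  have h3 : ∀ c, wall c → ¬ dead c := by decide
  exact h3 _ h.2.2.1 (hy.dead_of_le hqc.le hd)

theorem Valid.start_parent_of_V2 {t a c : ℤ} (h : Start y t a c) (hV : y t a = V2) :
    Start y (t - 4 * (c - a)) (a - 2 * (c - a)) c := by
  have hac := h.2.1
  have key : ∀ d, 0 ≤ d → d < c - a → (1 ≤ d → y (t - d) (a + d) = Ga) ∧
      (y (t - (d + 1)) (a + (d + 1)) = Ga ∨ y (t - (d + 1)) (a + (d + 1)) = V3) ∧
      wall (y (t - (d + 1)) c) := by
    intro d hd
    induction d, hd using Int.leInduction with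
    | base =>
      intro _
      refine ⟨fun h => by omega, ?_, ?_⟩
      · simpa using (hy.V2_prev hV).2.2
      · simpa using hy.wall_prev_right (by rw [hV]; decide) hac h.2.2.1 h.2.2.2
    | succ d hd ih =>
      intro hd'
      obtain ⟨-, h2, h3⟩ := ih (by omega)
      have h4 : y (t - (d + 1)) (a + (d + 1)) = Ga := h2.resolve_right fun h5 => by
        have := hy.start_not_wall h (show t - (d + 1) ≤ t by omega)
          (show a < a + (d + 1) by omega) (by omega)
        rw [h5] at this
        exact this rfl
      refine ⟨fun _ => h4, ?_, ?_⟩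
      · have := hy.Ga_prev h4
        rwa [show t - (d + 1) - 1 = t - (d + 1 + 1) by ring,
          show a + (d + 1) + 1 = a + (d + 1 + 1) by ring] at this
      · have := hy.wall_prev_right (by rw [h4]; decide) (show a + (d + 1) < c by omega) h3
          (fun r h5 h6 => hy.start_not_wall h (by omega) (by omega) h6)
        rwa [sub_sub] at this
  have hlast := (key (c - a - 1) (by omega) (by omega)).2
  rw [sub_add_cancel, add_sub_cancel] at hlast
  have h3 : y (t - (c - a)) c = V3 := hlast.1.resolve_left fun h5 => by
    rw [h5] at hlast
    cases hlast.2
  have := hy.start_of_triangle (show 1 ≤ c - a by omega) hV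
    (fun d h1 h2 => (key d (by omega) h2).1 h1) (by rwa [add_sub_cancel])
  rwa [add_sub_cancel] at this

theorem Valid.Gb_line_of_V1 {t a c : ℤ} (h : Start y t a c) (hV : y t a = V1) :
    (∀ d, 1 ≤ d → d < c - a → y (t - d) (a + d) = Gb) ∧ y (t - (c - a)) c = V2 := by
  have hac := h.2.1
  have key : ∀ d, 0 ≤ d → d < c - a → (1 ≤ d → y (t - d) (a + d) = Gb) ∧
      (y (t - (d + 1)) (a + (d + 1)) = Gb ∨ y (t - (d + 1)) (a + (d + 1)) = V2) ∧
      wall (y (t - (d + 1)) c) := by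
    intro d hd
    induction d, hd using Int.leInduction with
    | base =>
      intro _
      refine ⟨fun h => by omega, ?_, ?_⟩
      · simpa using (hy.V1_prev hV).2
      · simpa using hy.wall_prev_right (by rw [hV]; decide) hac h.2.2.1 h.2.2.2
    | succ d hd ih =>
      intro hd'
      obtain ⟨-, h2, h3⟩ := ih (by omega)
      have h4 : y (t - (d + 1)) (a + (d + 1)) = Gb := h2.resolve_right fun h5 => by
        have := hy.start_not_wall h (show t - (d + 1) ≤ t by omega)
          (show a < a + (d + 1) by omega) (by omega)
        rw [h5] at this
        exact this rfl
      refine ⟨fun _ => h4, ?_, ?_⟩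
      · have := hy.Gb_prev h4
        rwa [show t - (d + 1) - 1 = t - (d + 1 + 1) by ring,
          show a + (d + 1) + 1 = a + (d + 1 + 1) by ring] at this
      · have := hy.wall_prev_right (by rw [h4]; decide) (show a + (d + 1) < c by omega) h3
          (fun r h5 h6 => hy.start_not_wall h (by omega) (by omega) h6)
        rwa [sub_sub] at this
  refine ⟨fun d h1 h2 => (key d (by omega) h2).1 h1, ?_⟩
  have hlast := (key (c - a - 1) (by omega) (by omega)).2
  rw [sub_add_cancel, add_sub_cancel] at hlast
  refine hlast.1.resolve_left fun h5 => ?_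
  rw [h5] at hlast
  cases hlast.2

/-- The slow signal that makes the right wall does not cross the left wall. -/
theorem Valid.slow_not_cross {t a c : ℤ} (h : Start y t a c) (hV : y t a = V1)
    (hS : ∀ j, 1 ≤ j → j < c - a + 1 → y (t - (c - a) - (2 * j - 1)) (c - j) = S1 ∧
      y (t - (c - a) - 2 * j) (c - j) = S0) : False := by
  have hac := h.2.1
  obtain ⟨hGb, hV2⟩ := hy.Gb_line_of_V1 h hV
  have hz : ∀ e, 1 ≤ e → e ≤ 3 * (c - a) - 2 → ∃ r, a < r ∧ r ≤ c ∧ cL (y (t - e) r) = 0 := by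
    intro e h1 h2
    rcases lt_trichotomy e (c - a) with h3 | rfl | h3
    · exact ⟨a + e, by omega, by omega, by rw [hGb e h1 h3]; rfl⟩
    · exact ⟨c, hac, le_rfl, by rw [hV2]; rfl⟩
    · rcases Int.even_or_odd' (e - (c - a)) with ⟨j, hj | hj⟩
      · refine ⟨c - j, by omega, by omega, ?_⟩
        have := (hS j (by omega) (by omega)).2
        rw [show t - (c - a) - 2 * j = t - e by omega] at this
        rw [this]
        rfl
      · refine ⟨c - (j + 1), by omega, by omega, ?_⟩
        have := (hS (j + 1) (by omega) (by omega)).1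
        rw [show t - (c - a) - (2 * (j + 1) - 1) = t - e by omega] at this
        rw [this]
        rfl
  have hw : ∀ e, 0 ≤ e → e ≤ 3 * (c - a) - 1 → wall (y (t - e) a) := by
    intro e he
    induction e, he using Int.leInduction with
    | base => intro _; rw [sub_zero, hV]; rfl
    | succ e he ih =>
      intro he'
      rw [← sub_sub]
      refine (hy.wall_prev (ih (by omega))).resolve_right fun h2 => ?_
      rcases he.eq_or_lt with rfl | he
      · rw [sub_zero, hV] at h2
        cases h2
      obtain ⟨r, h3, h4, h5⟩ := hz e (by omega) (by omega)
      have := hy.rank (t := t - e) h3 (fun q h6 h7 =>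
        hy.start_not_wall h (by omega) h6 (by omega))
      rw [h5, h2] at this
      simp [cR] at this
  have h1 := hw (3 * (c - a) - 1) (by omega) le_rfl
  have h2 := (hS (c - a) (by omega) (by omega)).1
  rw [sub_sub_cancel, show t - (c - a) - (2 * (c - a) - 1) = t - (3 * (c - a) - 1) by ring] at h2
  rw [h2] at h1
  cases h1

theorem Valid.start_parent_of_V1 {t a c : ℤ} (h : Start y t a c) (hV : y t a = V1) :
    ∃ i, 1 ≤ i ∧ c = a + 2 * i ∧ Start y (t - 6 * i) a (a + 3 * i) := by
  have hac := h.2.1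
  obtain ⟨hGb, hV2⟩ := hy.Gb_line_of_V1 h hV
  by_cases hall : ∀ d, 1 ≤ d → d < 2 * (c - a) + 2 → y (t - (c - a) - d) (c + d) = Ga
  · obtain ⟨hS, -, -⟩ := hy.triangle_aux (k := c - a + 1) (by omega) hV2 hall
      (by omega) (by omega) (.inr (by omega))
    exact (hy.slow_not_cross h hV hS).elim
  · push Not at hall
    obtain ⟨d, h1, h2, h3⟩ := hall
    obtain ⟨i, ⟨hi, hi'⟩, hmin⟩ := Int.exists_least_of_bdd
      (P := fun d => 1 ≤ d ∧ y (t - (c - a) - d) (c + d) ≠ Ga) ⟨1, fun z hz => hz.1⟩ ⟨d, h1, h3⟩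
    have hGa : ∀ d, 1 ≤ d → d < i → y (t - (c - a) - d) (c + d) = Ga := by
      intro d h4 h5
      by_contra h6
      have := hmin d ⟨h4, h6⟩
      omega
    have h3' : y (t - (c - a) - i) (c + i) = V3 := by
      by_cases h4 : i = 1
      · subst h4
        exact ((hy.V2_prev hV2).2.2).resolve_left hi'
      · have := hy.Ga_prev (hGa (i - 1) (by omega) (by omega))
        rw [show t - (c - a) - (i - 1) - 1 = t - (c - a) - i by ring,
          show c + (i - 1) + 1 = c + i by ring] at this
        exact this.resolve_left hi'
    have hst := hy.start_of_triangle hi hV2 hGa h3'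
    rcases lt_trichotomy (c - 2 * i) a with h4 | h4 | h4
    · obtain ⟨hS, -, -⟩ := hy.triangle_aux (k := c - a + 1) hi hV2 hGa
        (by omega) (by omega) (.inl h3')
      exact (hy.slow_not_cross h hV hS).elim
    · refine ⟨i, hi, by omega, ?_⟩
      convert hst using 1 <;> omega
    · have h5 := hy.start_not_wall h (show t - (c - a) - 4 * i ≤ t by omega) h4 (by omega)
      rcases hst.1 with h6 | h6 <;> rw [h6] at h5 <;> exact absurd rfl h5

theorem Valid.exists_chain {t a c : ℤ} (h : Start y t a c) :
    ∃ c' e n, c ≤ c' ∧ 0 < n ∧ ∀ m : ℕ,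
      Start y (e - 2 * (3 ^ m * n)) (c' - 3 ^ m * n) c' ∧
        y (e - 2 * (3 ^ m * n)) (c' - 3 ^ m * n) = V2 := by
  have main : ∀ v : ℕ, ∀ t a c : ℤ, Start y t a c → ¬ (2 : ℤ) ^ v ∣ c - a →
      ∃ c' e n, c ≤ c' ∧ 0 < n ∧ ∀ m : ℕ,
        Start y (e - 2 * (3 ^ m * n)) (c' - 3 ^ m * n) c' ∧
          y (e - 2 * (3 ^ m * n)) (c' - 3 ^ m * n) = V2 := by
    intro v
    induction v with
    | zero => intro t a c _ h; simp at h
    | succ v ih =>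
      intro t a c h hv
      obtain ⟨n, hn⟩ : ∃ n, n = c - a := ⟨_, rfl⟩
      obtain ⟨e, he⟩ : ∃ e, e = t + 2 * n := ⟨_, rfl⟩
      have hpos := h.2.1
      by_cases hall : ∀ m : ℕ, Start y (e - 2 * (3 ^ m * n)) (c - 3 ^ m * n) c →
          y (e - 2 * (3 ^ m * n)) (c - 3 ^ m * n) = V2
      · have hst : ∀ m : ℕ, Start y (e - 2 * (3 ^ m * n)) (c - 3 ^ m * n) c := by
          intro m
          induction m with
          | zero =>
            convert h using 1
            · rw [he]; ring
            · rw [hn]; ring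
          | succ m ihm =>
            convert hy.start_parent_of_V2 ihm (hall m ihm) using 1 <;> ring
        exact ⟨c, e, n, le_rfl, by omega, fun m => ⟨hst m, hall m (hst m)⟩⟩
      · push Not at hall
        obtain ⟨m, h1, h2⟩ := hall
        obtain ⟨i, hi, h3, h4⟩ := hy.start_parent_of_V1 h1 (h1.1.resolve_right h2)
        obtain ⟨c', e', n', h5, h6, h7⟩ := ih _ _ _ h4 (by
          rintro ⟨x, hx⟩
          apply hv
          rw [← hn]
          have h8 : (2 : ℤ) ^ (v + 1) ∣ 3 ^ (m + 1) * n := by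
            refine ⟨x, ?_⟩
            have : 3 ^ m * n = 2 * i := by linarith
            rw [pow_succ, mul_right_comm, this, pow_succ]
            linarith
          exact (IsCoprime.pow (by norm_num [Int.isCoprime_iff_gcd_eq_one])).dvd_of_dvd_mul_left h8)
        exact ⟨c', e', n', by omega, h6, h7⟩
  refine main (c - a).toNat t a c h fun hd => ?_
  have hac := h.2.1
  have h1 := Int.le_of_dvd (by omega) hd
  have h2 : (c - a).toNat < 2 ^ (c - a).toNat := Nat.lt_two_pow_self
  zify at h2
  omega

end Chain

/-- The cell at `q` dies at time `e - 4 * q`. -/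
def XLine (y : ℤ → ℤ → Cell) (e : ℤ) : Prop := ∀ q, y (e - 4 * q) q = X0

/-- A sequence of starting walls, reaching back in time and to the left without bound. -/
def Chain (y : ℤ → ℤ → Cell) (c e n : ℤ) : Prop := 0 < n ∧ ∀ m : ℕ,
  Start y (e - 2 * (3 ^ m * n)) (c - 3 ^ m * n) c ∧ y (e - 2 * (3 ^ m * n)) (c - 3 ^ m * n) = V2

theorem exists_pow_gt {n : ℤ} (hn : 0 < n) (b : ℤ) : ∃ m : ℕ, b < 3 ^ m * n := by
  refine ⟨b.toNat, ?_⟩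
  have h2 : b.toNat < 3 ^ b.toNat := Nat.lt_pow_self (by norm_num)
  zify at h2
  nlinarith [Int.self_le_toNat b]

section DeadZone

variable {y : ℤ → ℤ → Cell} (hy : Valid y)
include hy

theorem Valid.xLine {t p : ℤ} (h : y t p = X0) : XLine y (t + 4 * p) := by
  have h3 : ∀ t p, y t p = X0 → y (t + 3) p = X3 := fun t p h => by
    have := hy.X2_next (hy.X1_next (hy.X0_next h))
    rwa [show t + 1 + 1 + 1 = t + 3 by ring] at this
  intro q
  rcases le_total p q with hpq | hqp
  · induction q, hpq using Int.leInduction with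
    | base => rwa [add_sub_cancel_right]
    | succ q _ ih =>
      have := hy.X1_prev (hy.X2_prev (hy.X3_prev (hy.X0_prev ih).1))
      rwa [show t + 4 * p - 4 * q - 1 - 1 - 1 - 1 = t + 4 * p - 4 * (q + 1) by ring] at this
  · induction q, hqp using Int.leInductionDown with
    | base => rwa [add_sub_cancel_right]
    | pred q _ ih =>
      have := (hy.X3_next (h3 _ _ ih)).2
      rwa [show t + 4 * p - 4 * q + 3 + 1 = t + 4 * p - 4 * (q - 1) by ring] at this

theorem Valid.dead_trichotomy : (∃ e, XLine y e) ∨ (∀ t p, y t p = D) ∨ ∀ t p, ¬ dead (y t p) := by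
  by_cases hX : ∃ t p, y t p = X0
  · obtain ⟨t, p, h⟩ := hX
    exact .inl ⟨_, hy.xLine h⟩
  push Not at hX
  right
  have hX1 : ∀ t p, y t p ≠ X1 := fun t p h => hX _ _ (hy.X1_prev h)
  have hX2 : ∀ t p, y t p ≠ X2 := fun t p h => hX1 _ _ (hy.X2_prev h)
  have hX3 : ∀ t p, y t p ≠ X3 := fun t p h => hX2 _ _ (hy.X3_prev h)
  have hD : ∀ t p, dead (y t p) → y t p = D := fun t p h => by
    have : ∀ x, dead x → x = D ∨ x = X0 ∨ x = X1 ∨ x = X2 ∨ x = X3 := by decide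
    have := this _ h
    simpa [hX, hX1, hX2, hX3] using this
  by_cases hd : ∃ t p, dead (y t p)
  swap
  · push Not at hd
    exact .inr (by simpa using hd)
  left
  obtain ⟨t, p, h⟩ := hd
  have hrow : ∀ q, y t q = D := by
    intro q
    apply hD
    rcases le_total p q with hpq | hqp
    · exact hy.dead_of_le hpq h
    · induction q, hqp using Int.leInductionDown with
      | base => exact h
      | pred q _ ih =>
        have := hy.col t (q - 1)
        rw [sub_add_cancel, hD _ _ ih] at this
        have h3 : ∀ x, cR x = cL D → dead x := by decide
        exact h3 _ this
  intro s q
  rcases le_total t s with hts | hst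
  · exact hD _ _ (hy.dead_of_time_le hts (by rw [hrow]; rfl))
  · induction s, hst using Int.leInductionDown with
    | base => exact hrow q
    | pred s _ ih => exact (hy.D_prev ih).resolve_right (hX3 _ _)

/-- An interval eventually dies. -/
theorem Valid.exists_dead_of_start {t a c : ℤ} (h : Start y t a c) : ∃ s p, dead (y s p) := by
  by_contra! hd
  obtain ⟨n, hn⟩ : ∃ n : ℕ, c - a ≤ n := ⟨(c - a).toNat, Int.self_le_toNat _⟩
  induction n generalizing t a c with
  | zero =>
    have := h.2.1
    omega
  | succ n ih =>
    have hw : ∀ s, t ≤ s → wall (y s c) := fun s hs =>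
      (hy.wall_of_time_le hs h.2.2.1).resolve_right (by simpa using hd s c)
    have key : ∀ j, 0 ≤ j → j < c - a → (y (t + 1 + 2 * j) (a + j) = S1 ∨
        y (t + 1 + 2 * j) (a + j) = WS ∨ y (t + 1 + 2 * j) (a + j) = T1) := by
      intro j hj
      induction j, hj using Int.leInduction with
      | base => intro _; simp [hy.V_next h.1]
      | succ j hj ihj =>
        intro hj'
        rcases hy.ST_next (ihj (by omega)) with h1 | h1 | h1 | h1
        · have := hy.ST0_next (.inl h1)
          rw [show t + 1 + 2 * j + 1 + 1 = t + 1 + 2 * (j + 1) by ring, add_assoc a] at this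
          tauto
        · have := hy.ST0_next (.inr h1)
          rw [show t + 1 + 2 * j + 1 + 1 = t + 1 + 2 * (j + 1) by ring, add_assoc a] at this
          tauto
        · obtain ⟨c', h2, h3⟩ := exists_start (c := c) (.inr h1) (by omega) (hw _ (by omega))
          exact (ih h3 (by omega)).elim
        · exact absurd h1 (by simpa using hd _ _)
    have hac := h.2.1
    have hlast := hw (t + 1 + 2 * (c - a - 1) + 1) (by omega)
    have hlast' := hw (t + 1 + 2 * (c - a - 1)) (by omega)
    have h1 := hy.ST_next (key (c - a - 1) (by omega) (by omega))
    rw [show a + (c - a - 1) + 1 = c by ring] at h1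
    rcases h1 with h1 | h1 | h1 | h1
    · rw [h1] at hlast; cases hlast
    · rw [h1] at hlast; cases hlast
    · have := (hy.V2_prev h1).1
      rw [add_sub_cancel_right] at this
      rw [this] at hlast'; cases hlast'
    · exact absurd h1 (by simpa using hd _ _)

variable {e' : ℤ} (hX : XLine y e')
include hX

theorem Valid.dead_iff (t p : ℤ) : dead (y t p) ↔ e' - 4 * p ≤ t := by
  constructor
  · intro h
    by_contra! hlt
    exact (hy.X0_prev (hX p)).2 (hy.dead_of_time_le (show t ≤ e' - 4 * p - 1 by omega) h)
  · intro h
    exact hy.dead_of_time_le h (by rw [hX]; rfl)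

theorem Valid.eq_of_dead {z : ℤ → ℤ → Cell} (hz : Valid z) (hX' : XLine z e') {t p : ℤ}
    (h : dead (y t p)) : y t p = z t p := by
  have h1 := (hy.dead_iff hX t p).1 h
  clear h
  induction t, h1 using Int.leInduction with
  | base => rw [hX, hX']
  | succ t ht ih =>
    have hn : ∀ c, dead c → ∀ o q d, rule o c q = some d → rule .n c .n = some d := by decide
    have hd := (hy.dead_iff hX t p).2 ht
    have h1 := hn _ hd _ _ _ (hy.step t p)
    rw [hn _ hd _ _ _ (ih ▸ hz.step t p)] at h1
    exact (Option.some.inj h1).symm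

theorem Valid.right_of_wall_eq {t c : ℤ} (hc : ¬ dead (y t c)) (hw : ∀ d, c < d → ¬ wall (y t d)) :
    cR (y t c) = 0 ∧ ∀ p, c < p → ¬ dead (y t p) → y t p = be := by
  have h0 : ∀ p, c ≤ p → ¬ dead (y t p) → cR (y t p) = 0 := by
    intro p hp hd
    by_contra h
    obtain ⟨r, h1, -, h2⟩ := hy.exists_wall_of_dead (t := t) (q := max (p + 1) (|e'| + |t|))
      (by omega) hd (Nat.pos_of_ne_zero h) ((hy.dead_iff hX _ _).2 (by
        rcases abs_cases e' with h | h <;> rcases abs_cases t with h' | h' <;> omega))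
    exact hw r (by omega) h2
  refine ⟨h0 c le_rfl hc, fun p hp hd => ?_⟩
  have h1 := h0 (p - 1) (by omega) (fun h => hd (hy.dead_of_le (by omega) h))
  have h2 := hy.col t (p - 1)
  rw [h1, sub_add_cancel] at h2
  have : ∀ x, cL x = 0 → cR x = 0 → ¬ wall x → x = be := by decide
  exact this _ h2.symm (h0 p hp.le hd) (hw p hp)

end DeadZone

theorem Valid.chain_wall {y : ℤ → ℤ → Cell} (hy : Valid y) {c e n t : ℤ}
    (hC : Chain y c e n) (h : ¬ dead (y t c)) : wall (y t c) := by
  obtain ⟨m, hm⟩ := exists_pow_gt hC.1 (e - t + |e| + |t|)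
  have := hy.wall_of_time_le (s := t) (by
    rcases abs_cases e with h | h <;> rcases abs_cases t with h' | h' <;> omega)
    (hC.2 m).1.2.2.1
  exact this.resolve_right h

theorem Valid.chain_not_wall {y : ℤ → ℤ → Cell} (hy : Valid y) {c e n t d : ℤ}
    (hC : Chain y c e n) (hcd : c < d) : ¬ wall (y t d) := by
  intro hw
  have hwd : ∀ x, wall x → ¬ dead x := by decide
  have hc : ∀ s d, c < d → wall (y s d) → wall (y s c) := fun s d h1 h2 =>
    hy.chain_wall hC fun h3 => hwd _ h2 (hy.dead_of_le h1.le h3)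
  obtain ⟨t', a', c', h1, h2⟩ := hy.exists_start_of_two_walls hcd (hc t d hcd hw) hw
  obtain ⟨c'', e'', n'', h3, h4, h5⟩ := hy.exists_chain h2
  have h6 := h2.2.1
  obtain ⟨m, hm⟩ := exists_pow_gt h4 (c'' - c)
  have h7 := (h5 m).1
  exact h7.2.2.2 c (by omega) (by omega) (hc _ c'' (by omega) h7.2.2.1)

section Determined

variable {y : ℤ → ℤ → Cell} (hy : Valid y) {c e n e' : ℤ} (hX : XLine y e') (hC : Chain y c e n)
include hy hX hC

theorem Valid.chain_right {t : ℤ} (h : ¬ dead (y t c)) : (y t c = W ∨ y t c = V3) ∧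
    ∀ p, c < p → ¬ dead (y t p) → y t p = be := by
  obtain ⟨h1, h2⟩ := hy.right_of_wall_eq hX h fun d hd => hy.chain_not_wall hC hd
  have : ∀ x, wall x → cR x = 0 → x = W ∨ x = V3 := by decide
  exact ⟨this _ (hy.chain_wall hC h) h1, h2⟩

theorem Valid.chain_row (m : ℕ) : y (e - 2 * (3 ^ m * n)) c = W ∧
    ∀ p, c - 3 ^ m * n < p → p < c → y (e - 2 * (3 ^ m * n)) p = ga := by
  obtain ⟨h1, h2⟩ := hC.2 m
  have hwd : ∀ x, wall x → ¬ dead x := by decide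
  have h3 := (hy.chain_right hX hC (hwd _ h1.2.2.1)).1
  have h4 := hy.rank h1.2.1 h1.2.2.2
  rw [h2] at h4
  constructor
  · rcases h3 with h3 | h3
    · exact h3
    · rw [h3] at h4
      simp [cL, cR] at h4
  · intro p hp hpc
    have h5 := hy.rank hp fun r h6 h7 => h1.2.2.2 r h6 (by omega)
    have h6 := hy.rank hpc fun r h6 h7 => h1.2.2.2 r (by omega) h7
    rw [h2] at h5
    have h7 : cL (y (e - 2 * (3 ^ m * n)) c) ≤ 2 := by
      rcases h3 with h3 | h3 <;> rw [h3] <;> decide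
    have : ∀ x, cR V2 ≤ cL x → cR x ≤ 2 → ¬ wall x → x = ga := by decide
    exact this _ h5 (h6.trans h7) (h1.2.2.2 p hp hpc)

end Determined

/-- Wall states with the same influence to the right. -/
def Similar (u v : Cell) : Prop :=
  u = v ∧ (wall u ∨ dead u) ∨ (u = W ∨ u = V3) ∧ (v = W ∨ v = V3)

instance : DecidableRel Similar := fun u v => by unfold Similar; infer_instance

theorem Similar.step {u v : Cell} (h : Similar u v) {o o' : MR} {q : ML} {u' v' : Cell}
    (hu : rule o u q = some u') (hv : rule o' v q = some v') : Similar u' v' := by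
  have : ∀ u v, Similar u v → ∀ q o u', rule o u q = some u' → ∀ o' v',
    rule o' v q = some v' → Similar u' v' := by decide +kernel
  exact this _ _ h _ _ _ hu _ _ hv

theorem Valid.eq_of_similar {y z : ℤ → ℤ → Cell} (hy : Valid y) (hz : Valid z) {t₀ a : ℤ}
    (ha : Similar (y t₀ a) (z t₀ a)) (h : ∀ p, a < p → y t₀ p = z t₀ p) {t : ℤ} (ht : t₀ ≤ t) :
    Similar (y t a) (z t a) ∧ ∀ p, a < p → y t p = z t p := by
  induction t, ht using Int.leInduction with
  | base => exact ⟨ha, h⟩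
  | succ t _ ih =>
    obtain ⟨h1, h2⟩ := ih
    refine ⟨h1.step (hy.step t a) (by rw [h2 _ (lt_add_one a)]; exact hz.step t a), ?_⟩
    intro p hp
    have h3 : oR (y t (p - 1)) = oR (z t (p - 1)) := by
      rcases (show a = p - 1 ∨ a < p - 1 by omega) with h4 | h4
      · have : ∀ u v, Similar u v → oR u = oR v := by decide
        rw [← h4]
        exact this _ _ h1
      · rw [h2 _ h4]
    have h4 := hy.step t p
    rw [h3, h2 _ hp, h2 (p + 1) (by omega), hz.step t p] at h4
    exact (Option.some.inj h4).symm

theorem Valid.eq_of_chain {y z : ℤ → ℤ → Cell} (hy : Valid y) (hz : Valid z) {c e n e' : ℤ}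
    (hX : XLine y e') (hX' : XLine z e') (hC : Chain y c e n) (hC' : Chain z c e n) : y = z := by
  funext t p
  obtain ⟨m, hm⟩ := exists_pow_gt hC.1 (|e| + |t| + |c| + |p|)
  have hwd : ∀ x, wall x → ¬ dead x := by decide
  refine (hy.eq_of_similar hz (t₀ := e - 2 * (3 ^ m * n)) (a := c - 3 ^ m * n) (t := t) ?_ ?_ ?_).2
    p ?_
  · rw [(hC.2 m).2, (hC'.2 m).2]
    decide
  · intro q hq
    rcases lt_trichotomy q c with h | rfl | h
    · rw [(hy.chain_row hX hC m).2 q hq h, (hz.chain_row hX' hC' m).2 q hq h]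
    · rw [(hy.chain_row hX hC m).1, (hz.chain_row hX' hC' m).1]
    · by_cases hd : dead (y (e - 2 * (3 ^ m * n)) q)
      · exact hy.eq_of_dead hX hz hX' hd
      · rw [(hy.chain_right hX hC (hwd _ (hC.2 m).1.2.2.1)).2 q h hd,
          (hz.chain_right hX' hC' (hwd _ (hC'.2 m).1.2.2.1)).2 q h ?_]
        rwa [hz.dead_iff hX', ← hy.dead_iff hX]
  · rcases abs_cases e with h | h <;> rcases abs_cases t with h' | h' <;>
      rcases abs_cases c with h1 | h1 <;> rcases abs_cases p with h2 | h2 <;> omega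
  · rcases abs_cases e with h | h <;> rcases abs_cases t with h' | h' <;>
      rcases abs_cases c with h1 | h1 <;> rcases abs_cases p with h2 | h2 <;> omega

/-- Only countably many diagrams contain a start. -/
theorem countable_start :
    {x : ℤ × ℤ → Cell | x ∈ shiftSpace ∧ ∃ t a c, Start (fun t p => x (p, -t)) t a c}.Countable := by
  refine Set.Countable.mono (s₂ := ⋃ k : ℤ × ℤ × ℤ × ℤ, {x : ℤ × ℤ → Cell |
    x ∈ shiftSpace ∧ XLine (fun t p => x (p, -t)) k.1 ∧
      Chain (fun t p => x (p, -t)) k.2.1 k.2.2.1 k.2.2.2}) ?_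
    (Set.countable_iUnion fun k => Set.Subsingleton.countable ?_)
  · rintro x ⟨hx, t, a, c, h⟩
    obtain ⟨c', e, n, -, h1, h2⟩ := Valid.exists_chain hx h
    obtain ⟨s, p, hd⟩ := Valid.exists_dead_of_start hx h
    rcases Valid.dead_trichotomy hx with ⟨e', h3⟩ | h3 | h3
    · exact Set.mem_iUnion.2 ⟨(e', c', e, n), hx, h3, h1, h2⟩
    · have := h.1
      beta_reduce at this
      rw [h3] at this
      simp at this
    · exact absurd hd (h3 s p)
  · rintro x ⟨hx, h1, h2⟩ x' ⟨hx', h1', h2'⟩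
    have := Valid.eq_of_chain hx hx' h1 h1' h2 h2'
    funext ⟨a, b⟩
    simpa using congrFun (congrFun this (-b)) a

section NoStart

variable {y : ℤ → ℤ → Cell} (hy : Valid y) (hN : ∀ t a c, ¬ Start y t a c)
include hy hN

theorem Valid.wall_unique_row {t a b : ℤ} (ha : wall (y t a)) (hb : wall (y t b)) : a = b := by
  rcases lt_trichotomy a b with h | h | h
  · obtain ⟨_, _, _, -, h1⟩ := hy.exists_start_of_two_walls h ha hb
    exact absurd h1 (hN _ _ _)
  · exact h
  · obtain ⟨_, _, _, -, h1⟩ := hy.exists_start_of_two_walls h hb ha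
    exact absurd h1 (hN _ _ _)

omit hN in
theorem Valid.wall_back {s t b : ℤ} (hst : s ≤ t) (hb : wall (y t b)) :
    wall (y s b) ∨ ∃ r, s < r ∧ r ≤ t ∧ y r b = V2 := by
  induction s, hst using Int.leInductionDown with
  | base => exact .inl hb
  | pred s hs ih =>
    rcases ih with h | ⟨r, h1, h2, h3⟩
    · rcases hy.wall_prev h with h | h
      · exact .inl h
      · exact .inr ⟨s, by omega, hs, h⟩
    · exact .inr ⟨r, by omega, h2, h3⟩

theorem Valid.wall_unique {s t a b : ℤ} (ha : wall (y s a)) (hb : wall (y t b)) : a = b := by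
  wlog hst : s ≤ t generalizing s t a b
  · exact (this hb ha (by omega)).symm
  rcases hy.wall_back hst hb with h | ⟨r, h1, h2, h3⟩
  · exact hy.wall_unique_row hN ha h
  have hrb : wall (y r b) := by rw [h3]; rfl
  have hwd : ∀ x, wall x → ¬ dead x := by decide
  rcases hy.wall_of_time_le h1.le ha with h4 | h4
  · exact hy.wall_unique_row hN h4 hrb
  · have hba : b < a := by
      by_contra! h
      exact hwd _ hrb (hy.dead_of_le h h4)
    obtain ⟨q, h5, -, h6⟩ := hy.exists_wall_of_dead hba (hwd _ hrb) (by rw [h3]; decide) h4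
    exact absurd (hy.wall_unique_row hN h6 hrb) (by omega)

omit hN in
theorem Valid.V2_unique_time {s t b : ℤ} (hst : s < t) (hs : wall (y s b)) (ht : y t b = V2) :
    False := by
  have h1 := hy.wall_of_time_le (show s ≤ t - 1 by omega) hs
  rw [(hy.V2_prev ht).1] at h1
  simp [wall, dead] at h1

theorem Valid.V1_unique_time {s t a b : ℤ} (hst : s < t) (hs : y s a = V1) (ht : y t b = V1) :
    False := by
  obtain rfl := hy.wall_unique hN (s := s) (t := t) (by rw [hs]; rfl) (by rw [ht]; rfl)
  have key : ∀ d, 1 ≤ d → y (t - d) (a + d) = Gb := by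
    have hV2 : ∀ r d, 1 ≤ d → y r (a + d) ≠ V2 := fun r d hd h => by
      have := hy.wall_unique hN (s := s) (t := r) (a := a) (b := a + d) (by rw [hs]; rfl)
        (by rw [h]; rfl)
      omega
    intro d hd
    induction d, hd using Int.leInduction with
    | base => exact (hy.V1_prev ht).2.resolve_right (hV2 _ _ le_rfl)
    | succ d hd ih =>
      have := hy.Gb_prev ih
      rw [sub_sub, add_assoc] at this
      exact this.resolve_right (hV2 _ _ (by omega))
  have h1 := key (t - s) (by omega)
  rw [sub_sub_cancel] at h1
  have h2 := hy.rank (t := s) (show a < a + (t - s) by omega) fun r h3 h4 h5 => by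
    have := hy.wall_unique_row hN h5 (b := a) (by rw [hs]; rfl)
    omega
  rw [h1, hs] at h2
  simp [cL, cR] at h2

theorem Valid.V3_unique_time {s t a b : ℤ} (hst : s < t) (hs : y s a = V3) (ht : y t b = V3) :
    False := by
  obtain rfl := hy.wall_unique hN (s := s) (t := t) (by rw [hs]; rfl) (by rw [ht]; rfl)
  have key : ∀ d, 1 ≤ d → y (t - d) (a - d) = F := by
    have hV : ∀ r d, 1 ≤ d → ¬ (y r (a - d) = V1 ∨ y r (a - d) = V2) := fun r d hd h => by
      have := hy.wall_unique hN (s := s) (t := r) (a := a) (b := a - d) (by rw [hs]; rfl)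
        (by rcases h with h | h <;> rw [h] <;> rfl)
      omega
    intro d hd
    induction d, hd using Int.leInduction with
    | base => exact (hy.V3_prev ht).2.resolve_right (hV _ _ le_rfl)
    | succ d hd ih =>
      have := hy.F_prev ih
      rw [sub_sub, sub_sub] at this
      exact this.resolve_right (hV _ _ (by omega))
  have h1 := key (t - s) (by omega)
  rw [sub_sub_cancel] at h1
  have h2 := hy.rank (t := s) (show a - (t - s) < a by omega) fun r h3 h4 h5 => by
    have := hy.wall_unique_row hN h5 (b := a) (by rw [hs]; rfl)
    omega
  rw [h1, hs] at h2
  simp [cL, cR] at h2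

end NoStart

theorem exists_bound {E : ℤ → Prop} (h : ∀ s t, s < t → E s → E t → False) :
    ∃ t₀, ∀ t ≤ t₀, ¬ E t := by
  by_cases hE : ∃ t, E t
  · obtain ⟨t, ht⟩ := hE
    exact ⟨t - 1, fun s hs hs' => h s t (by omega) hs' ht⟩
  · push Not at hE
    exact ⟨0, fun t _ => hE t⟩

/-- Nothing irreversible happens up to time `t₀`. -/
structure Quiet (y : ℤ → ℤ → Cell) (t₀ : ℤ) : Prop where
  isW : ∀ t p, t ≤ t₀ → wall (y t p) → y t p = W
  kill : ∀ t p, t < t₀ → wall (y t p) → y (t + 1) p ≠ X0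
  cross : ∀ t p, t < t₀ → (y t p = S0 ∨ y t p = S1) → y t (p + 1) ≠ Ga

theorem Valid.Ga_back {y : ℤ → ℤ → Cell} (hy : Valid y) {t₀ t p d : ℤ}
    (h3 : ∀ t p, t ≤ t₀ → y t p ≠ V3) (ht : t ≤ t₀) (h : y t p = Ga) (hd : 0 ≤ d) :
    y (t - d) (p + d) = Ga := by
  induction d, hd using Int.leInduction with
  | base => simpa using h
  | succ d hd ih =>
    have := hy.Ga_prev ih
    rw [sub_sub, add_assoc] at this
    exact this.resolve_right (h3 _ _ (by omega))

theorem Valid.exists_quiet {y : ℤ → ℤ → Cell} (hy : Valid y) (hN : ∀ t a c, ¬ Start y t a c) :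
    ∃ t₀, Quiet y t₀ := by
  obtain ⟨t₁, h1⟩ := exists_bound (E := fun t => ∃ p, y t p = V1)
    fun s t hst ⟨a, ha⟩ ⟨b, hb⟩ => hy.V1_unique_time hN hst ha hb
  obtain ⟨t₂, h2⟩ := exists_bound (E := fun t => ∃ p, y t p = V2) fun s t hst ⟨a, ha⟩ ⟨b, hb⟩ => by
    obtain rfl := hy.wall_unique hN (s := s) (t := t) (by rw [ha]; rfl) (by rw [hb]; rfl)
    exact hy.V2_unique_time hst (by rw [ha]; rfl) hb
  obtain ⟨t₃, h3⟩ := exists_bound (E := fun t => ∃ p, y t p = V3)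
    fun s t hst ⟨a, ha⟩ ⟨b, hb⟩ => hy.V3_unique_time hN hst ha hb
  obtain ⟨t₄, h4⟩ := exists_bound (E := fun t => ∃ p, wall (y t p) ∧ y (t + 1) p = X0)
    fun s t hst ⟨a, ha, ha'⟩ ⟨b, hb, hb'⟩ => by
      obtain rfl := hy.wall_unique hN ha hb
      have hwd : ∀ x, wall x → ¬ dead x := by decide
      exact hwd _ hb (hy.dead_of_time_le (show s + 1 ≤ t by omega) (by rw [ha']; rfl))
  push Not at h1 h2 h3 h4
  have h3' : ∀ t p, t ≤ t₃ → y t p ≠ V3 := fun t p ht => h3 t ht p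
  obtain ⟨t₅, h5⟩ := exists_bound (E := fun t => t ≤ min t₂ t₃ ∧
    ∃ p, (y t p = S0 ∨ y t p = S1) ∧ y t (p + 1) = Ga)
    fun s t hst ⟨hs, a, ha, ha'⟩ ⟨ht, b, hb, hb'⟩ => by
      have hGa := hy.Ga_back h3' (by omega) hb' (d := t - s) (by omega)
      rw [sub_sub_cancel] at hGa
      have hne : ∀ p q, p < q → y s p = Ga → y s q = Ga → False := by
        intro p q hpq hp hq
        obtain ⟨r, h6, h7, h8⟩ := hy.exists_wall hpq (by rw [hp, hq]; decide : cL (y s q) < _)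
        have h9 := hy.Ga_back h3' (by omega) hp (d := r - p) (by omega)
        rw [add_sub_cancel] at h9
        rcases hy.wall_back (show s - (r - p) ≤ s by omega) h8 with h | ⟨x, -, h10, h11⟩
        · rw [h9] at h
          cases h
        · exact h2 x (by omega) r h11
      have heq : b + 1 + (t - s) = a + 1 := by
        rcases lt_trichotomy (b + 1 + (t - s)) (a + 1) with h | h | h
        · exact (hne _ _ h hGa ha').elim
        · exact h
        · exact (hne _ _ h ha' hGa).elim
      have hGa' := hy.Ga_back h3' (by omega) hb' (d := t - s - 1) (by omega)
      rw [show t - (t - s - 1) = s + 1 by ring, show b + 1 + (t - s - 1) = a by omega] at hGa'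
      have := hy.loc (Q := fun _ c r d => c = S0 ∨ c = S1 → r = Ga → d ≠ Ga)
        (by decide +kernel) s a
      exact this ha ha' hGa'
  push Not at h5
  refine ⟨min (min t₁ t₂) (min t₃ (min t₄ t₅)), ⟨fun t p ht hw => ?_, fun t p ht hw => ?_,
    fun t p ht hs => ?_⟩⟩
  · have : ∀ x, wall x → x = W ∨ x = V1 ∨ x = V2 ∨ x = V3 ∨ x = WS := by decide
    rcases this _ hw with h | h | h | h | h
    · exact h
    · exact absurd h (h1 t (by omega) p)
    · exact absurd h (h2 t (by omega) p)
    · exact absurd h (h3 t (by omega) p)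
    · rcases hy.WS_prev h with h | h
      · exact absurd h (h1 _ (by omega) p)
      · exact absurd h (h2 _ (by omega) p)
  · exact h4 t (by omega) p hw
  · exact h5 t (by omega) (by omega) p hs

/-- The predecessor of a resting cell. -/
def stay : Cell → Cell
  | S0 | Ga => al
  | Gb | X0 => be
  | F | T0 => ga
  | S1 => S0
  | T1 => T0
  | X1 => X0
  | X2 => X1
  | X3 => X2
  | x => x

/-- The local rule backwards in time, as long as nothing irreversible happens. -/
def back (a b c : Cell) : Cell :=
  if c = F then F else if c = S0 then S1 else if c = T0 then T1 else
  if a = Ga then Ga else if a = Gb then Gb else if a = X0 then X3 else stay b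

section Back

variable {y : ℤ → ℤ → Cell} (hy : Valid y) {t₀ t : ℤ} (hQ : Quiet y t₀) (ht : t < t₀)
include hy hQ ht

theorem Valid.quiet_loc {Q : Cell → Cell → Cell → Cell → Prop}
    (h : ∀ c l, cR l = cL c → (wall l → l = W) → (wall c → c = W) →
      ∀ r, cR c = cL r → (wall r → r = W) →
      ∀ d, rule (oR l) c (oL r) = some d → (wall d → d = W) →
      ((l = S0 ∨ l = S1) → c ≠ Ga) → ((c = S0 ∨ c = S1) → r ≠ Ga) → (wall c → d ≠ X0) →
        Q l c r d) (p : ℤ) :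
    Q (y t (p - 1)) (y t p) (y t (p + 1)) (y (t + 1) p) :=
  h _ _ (by simpa using hy.col t (p - 1)) (hQ.isW _ _ ht.le) (hQ.isW _ _ ht.le) _ (hy.col t p)
    (hQ.isW _ _ ht.le) _ (hy.step t p) (hQ.isW _ _ (by omega))
    (by simpa using hQ.cross t (p - 1) ht) (hQ.cross t p ht) (hQ.kill t p ht)

set_option synthInstance.maxSize 1000 in
set_option synthInstance.maxHeartbeats 200000 in
theorem Valid.quiet_right (p : ℤ) : (y (t + 1) (p + 1) = F ↔ y t p = F) ∧
    (y (t + 1) (p + 1) = S0 ↔ y t p = S1) ∧ (y (t + 1) (p + 1) = T0 ↔ y t p = T1) := by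
  have := hy.quiet_loc hQ ht (Q := fun l _ _ d => (d = F ↔ l = F) ∧ (d = S0 ↔ l = S1) ∧
    (d = T0 ↔ l = T1)) (by decide +kernel) (p + 1)
  rwa [add_sub_cancel_right] at this

set_option synthInstance.maxSize 1000 in
set_option synthInstance.maxHeartbeats 200000 in
theorem Valid.quiet_left (p : ℤ) : (y (t + 1) (p - 1) = Ga ↔ y t p = Ga) ∧
    (y (t + 1) (p - 1) = Gb ↔ y t p = Gb) ∧ (y (t + 1) (p - 1) = X0 ↔ y t p = X3) := by
  have := hy.quiet_loc hQ ht (Q := fun _ _ r d => (d = Ga ↔ r = Ga) ∧ (d = Gb ↔ r = Gb) ∧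
    (d = X0 ↔ r = X3)) (by decide +kernel) (p - 1)
  rwa [sub_add_cancel] at this

set_option synthInstance.maxSize 1000 in
set_option synthInstance.maxHeartbeats 200000 in
theorem Valid.eq_back (p : ℤ) :
    y t p = back (y (t + 1) (p - 1)) (y (t + 1) p) (y (t + 1) (p + 1)) := by
  obtain ⟨h1, h2, h3⟩ := hy.quiet_right hQ ht p
  obtain ⟨h4, h5, h6⟩ := hy.quiet_left hQ ht p
  have h7 := hy.quiet_loc hQ ht (Q := fun _ c _ d => c = F ∨ c = S1 ∨ c = T1 ∨ c = Ga ∨ c = Gb ∨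
    c = X3 ∨ c = stay d) (by decide +kernel) p
  unfold back
  split_ifs <;> simp_all

end Back

theorem Valid.eq_of_quiet_row {y z : ℤ → ℤ → Cell} (hy : Valid y) (hz : Valid z) {t₀ : ℤ}
    (hQ : Quiet y t₀) (hQ' : Quiet z t₀) (h : ∀ p, y t₀ p = z t₀ p) : y = z := by
  funext t p
  rcases le_total t₀ t with ht | ht
  · exact hy.eq_of_row hz h t ht p
  · induction t, ht using Int.leInductionDown generalizing p with
    | base => exact h p
    | pred t ht ih =>
      rw [hy.eq_back hQ (by omega), hz.eq_back hQ' (by omega), sub_add_cancel, ih, ih, ih]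

theorem exists_forall_ge_eq {f : ℕ → ℕ} (h : Antitone f) : ∃ n, ∀ m, n ≤ m → f m = f n := by
  obtain ⟨n, hn⟩ := WellFoundedGT.monotone_chain_condition
    (⟨fun k => OrderDual.toDual (f k), fun a b hab => h hab⟩ : ℕ →o ℕᵒᵈ)
  exact ⟨n, fun m hm => (OrderDual.toDual.injective (hn m hm)).symm⟩

theorem eq_of_flat {a b : Cell} (ha : ¬ wall a) (hb : ¬ wall b) (ha' : cL a = cR a)
    (hb' : cL b = cR b) (h : cR a = cR b) : a = b := by
  revert a b
  decide

theorem exists_eventually_const {u : ℤ → Cell} (hc : ∀ p, cR (u p) = cL (u (p + 1)))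
    (hw : ∀ a b, wall (u a) → wall (u b) → a = b) :
    ∃ (N : ℤ) (a b : Cell), (∀ p, N < p → u p = a) ∧ ∀ p, p < -N → u p = b := by
  obtain ⟨K, hK0, hK⟩ : ∃ K, 0 ≤ K ∧ ∀ p, K ≤ |p| → ¬ wall (u p) := by
    by_cases h : ∃ a, wall (u a)
    · obtain ⟨a, ha⟩ := h
      refine ⟨|a| + 1, by positivity, fun p hp h => ?_⟩
      rw [hw _ _ h ha] at hp
      omega
    · push Not at h
      exact ⟨0, le_rfl, fun p _ => h p⟩
  have hle : ∀ x, ¬ wall x → cL x ≤ cR x := by decide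
  have h3 : ∀ x, cR x ≤ 3 := by decide
  obtain ⟨n, hn⟩ := exists_forall_ge_eq (f := fun k : ℕ => 3 - cR (u (K + k)))
    (antitone_nat_of_succ_le fun k => by
      have h1 := hle _ (hK (K + k + 1) (by rw [abs_of_nonneg] <;> omega))
      rw [← hc] at h1
      push_cast
      rw [← add_assoc]
      omega)
  obtain ⟨m, hm⟩ := exists_forall_ge_eq (f := fun k : ℕ => cR (u (-K - k - 1)))
    (antitone_nat_of_succ_le fun k => by
      have h1 := hle _ (hK (-K - k - 1) (by rw [abs_of_nonpos] <;> omega))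
      have h2 := hc (-K - k - 2)
      rw [show -K - k - 2 + 1 = -K - k - 1 by ring] at h2
      push_cast
      rw [show -K - (k + 1 : ℤ) - 1 = -K - k - 2 by ring]
      omega)
  have hR : ∀ p, K + n ≤ p → cR (u p) = cR (u (K + n)) := fun p hp => by
    have := hn (p - K).toNat (by omega)
    rw [show K + ((p - K).toNat : ℤ) = p by omega] at this
    have h1 := h3 (u p)
    have h2 := h3 (u (K + n))
    omega
  have hL : ∀ p, p ≤ -K - m - 1 → cR (u p) = cR (u (-K - m - 1)) := fun p hp => by
    have := hm (-K - p - 1).toNat (by omega)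
    rwa [show -K - ((-K - p - 1).toNat : ℤ) - 1 = p by omega] at this
  have hcp : ∀ p, cL (u p) = cR (u (p - 1)) := fun p => by
    rw [hc, sub_add_cancel]
  refine ⟨K + n + m + 2, u (K + n + 1), u (-K - m - 1), fun p hp => ?_, fun p hp => ?_⟩
  · refine eq_of_flat (hK _ ?_) (hK _ ?_) ?_ ?_ ?_
    · rw [abs_of_nonneg] <;> omega
    · rw [abs_of_nonneg] <;> omega
    · rw [hcp, hR _ (by omega), hR p (by omega)]
    · rw [hcp, hR _ (by omega), hR (K + n + 1) (by omega)]
    · rw [hR _ (by omega), hR (K + n + 1) (by omega)]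
  · refine eq_of_flat (hK _ ?_) (hK _ ?_) ?_ ?_ ?_
    · rw [abs_of_nonpos] <;> omega
    · rw [abs_of_nonpos] <;> omega
    · rw [hcp, hL _ (by omega), hL p (by omega)]
    · rw [hcp, hL _ (by omega)]
    · rw [hL _ (by omega)]

theorem countable_eventually_const :
    {u : ℤ → Cell | ∃ (N : ℤ) (a b : Cell), (∀ p, N < p → u p = a) ∧
      ∀ p, p < -N → u p = b}.Countable := by
  have : {u : ℤ → Cell | ∃ (N : ℤ) (a b : Cell), (∀ p, N < p → u p = a) ∧
      ∀ p, p < -N → u p = b} = ⋃ k : ℤ × Cell × Cell,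
        {u : ℤ → Cell | (∀ p, k.1 < p → u p = k.2.1) ∧ ∀ p, p < -k.1 → u p = k.2.2} := by
    ext u
    simp only [Set.mem_iUnion, Prod.exists]
    rfl
  rw [this]
  refine Set.countable_iUnion fun ⟨N, a, b⟩ => Set.Finite.countable ?_
  refine Set.Finite.of_injOn (f := fun u : ℤ → Cell => fun i : Set.Icc (-N) N => u i)
    (t := Set.univ) (fun _ _ => trivial) ?_ Set.finite_univ
  rintro u ⟨hu1, hu2⟩ v ⟨hv1, hv2⟩ huv
  funext p
  by_cases h1 : N < p
  · rw [hu1 p h1, hv1 p h1]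
  by_cases h2 : p < -N
  · rw [hu2 p h2, hv2 p h2]
  exact congrFun huv ⟨p, by omega, by omega⟩

theorem countable_no_start :
    {x : ℤ × ℤ → Cell | x ∈ shiftSpace ∧ ∀ t a c, ¬ Start (fun t p => x (p, -t)) t a c}.Countable := by
  refine Set.Countable.mono (s₂ := ⋃ t₀ : ℤ, {x : ℤ × ℤ → Cell | x ∈ shiftSpace ∧
    (∀ t a c, ¬ Start (fun t p => x (p, -t)) t a c) ∧ Quiet (fun t p => x (p, -t)) t₀}) ?_
    (Set.countable_iUnion fun t₀ => ?_)
  · rintro x ⟨hx, hN⟩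
    obtain ⟨t₀, h⟩ := Valid.exists_quiet hx hN
    exact Set.mem_iUnion.2 ⟨t₀, hx, hN, h⟩
  · refine Set.MapsTo.countable_of_injOn (f := fun x : ℤ × ℤ → Cell => fun p => x (p, -t₀))
      (t := _) ?_ ?_ countable_eventually_const
    · rintro x ⟨hx, hN, -⟩
      exact exists_eventually_const (fun p => hx.col t₀ p)
        fun a b ha hb => Valid.wall_unique_row hx hN (t := t₀) ha hb
    · rintro x ⟨hx, -, hQ⟩ x' ⟨hx', -, hQ'⟩ h
      have := Valid.eq_of_quiet_row hx hx' hQ hQ' fun p => congrFun h p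
      funext ⟨a, b⟩
      simpa using congrFun (congrFun this (-b)) a

theorem countable_shiftSpace : shiftSpace.Countable := by
  refine (countable_start.union countable_no_start).mono fun x hx => ?_
  by_cases h : ∃ t a c, Start (fun t p => x (p, -t)) t a c
  · exact .inl ⟨hx, h⟩
  · push Not at h
    exact .inr ⟨hx, h⟩

/-- The dying zone: the cell `p` dies at time `6 * n - 4 * p`. -/
def post (n s p : ℤ) : Cell :=
  if s < 6 * n - 4 * p then be else if s = 6 * n - 4 * p then X0
  else if s = 6 * n - 4 * p + 1 then X1 else if s = 6 * n - 4 * p + 2 then X2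
  else if s = 6 * n - 4 * p + 3 then X3 else D

theorem post_cases (n s p : ℤ) : s < 6 * n - 4 * p ∧ post n s p = be ∨
    s = 6 * n - 4 * p ∧ post n s p = X0 ∨ s = 6 * n - 4 * p + 1 ∧ post n s p = X1 ∨
    s = 6 * n - 4 * p + 2 ∧ post n s p = X2 ∨ s = 6 * n - 4 * p + 3 ∧ post n s p = X3 ∨
    6 * n - 4 * p + 3 < s ∧ post n s p = D := by
  unfold post
  split_ifs <;> simp <;> omega

theorem oR_post (n s p : ℤ) : oR (post n s p) = .n := by
  rcases post_cases n s p with ⟨-, h⟩ | ⟨-, h⟩ | ⟨-, h⟩ | ⟨-, h⟩ | ⟨-, h⟩ | ⟨-, h⟩ <;>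
    rw [h] <;> rfl

theorem post_step (n s p : ℤ) :
    rule .n (post n s p) (oL (post n s (p + 1))) = some (post n (s + 1) p) := by
  rcases post_cases n s p with ⟨h1, h⟩ | ⟨h1, h⟩ | ⟨h1, h⟩ | ⟨h1, h⟩ | ⟨h1, h⟩ | ⟨h1, h⟩ <;>
  rcases post_cases n s (p + 1) with
    ⟨h2, h'⟩ | ⟨h2, h'⟩ | ⟨h2, h'⟩ | ⟨h2, h'⟩ | ⟨h2, h'⟩ | ⟨h2, h'⟩ <;> try omega
  all_goals
    rcases post_cases n (s + 1) p with
      ⟨h3, h''⟩ | ⟨h3, h''⟩ | ⟨h3, h''⟩ | ⟨h3, h''⟩ | ⟨h3, h''⟩ | ⟨h3, h''⟩ <;> try omega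
    all_goals rw [h, h', h'']; rfl

theorem post_col (n s p : ℤ) : cR (post n s p) = cL (post n s (p + 1)) := by
  rcases post_cases n s p with ⟨h1, h⟩ | ⟨h1, h⟩ | ⟨h1, h⟩ | ⟨h1, h⟩ | ⟨h1, h⟩ | ⟨h1, h⟩ <;>
  rcases post_cases n s (p + 1) with
    ⟨h2, h'⟩ | ⟨h2, h'⟩ | ⟨h2, h'⟩ | ⟨h2, h'⟩ | ⟨h2, h'⟩ | ⟨h2, h'⟩ <;> try omega
  all_goals rw [h, h']; rfl

/-- The first phase of an interval of length `n`. -/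
def prim (n s p : ℤ) : Cell :=
  if p ≤ 0 then (if s ≤ 0 then V1 else if s = 1 then WS else W)
  else if n ≤ p then (if s = n then V3 else W)
  else if p < s / 2 then be
  else if p = s / 2 then (if s % 2 = 0 then S0 else S1)
  else if s < n then (if p < s then al else if p = s then F else ga)
  else (if p < 2 * n - s then al else if p = 2 * n - s then Ga else ga)

section Prim

variable {n s p : ℤ}

theorem prim_cases (h0 : 0 < p) (hn : p < n) :
    p < s / 2 ∧ prim n s p = be ∨
    p = s / 2 ∧ s % 2 = 0 ∧ prim n s p = S0 ∨ p = s / 2 ∧ s % 2 = 1 ∧ prim n s p = S1 ∨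
    s / 2 < p ∧ p < s ∧ p < 2 * n - s ∧ prim n s p = al ∨
    s / 2 < p ∧ s < n ∧ p = s ∧ prim n s p = F ∨
    s / 2 < p ∧ n ≤ s ∧ p = 2 * n - s ∧ prim n s p = Ga ∨
    s / 2 < p ∧ (s < p ∨ 2 * n - s < p) ∧ prim n s p = ga := by
  unfold prim
  rw [if_neg (by omega), if_neg (by omega)]
  split_ifs <;> simp <;> omega

theorem prim_left (h0 : p ≤ 0) : s ≤ 0 ∧ prim n s p = V1 ∨ s = 1 ∧ prim n s p = WS ∨
    1 < s ∧ prim n s p = W := by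
  unfold prim
  rw [if_pos h0]
  split_ifs <;> simp <;> omega

theorem prim_right (h0 : 0 < n) (hn : n ≤ p) : s = n ∧ prim n s p = V3 ∨
    s ≠ n ∧ prim n s p = W := by
  unfold prim
  rw [if_neg (by omega), if_pos hn]
  split_ifs <;> simp <;> omega

theorem oR_prim (hs : 0 ≤ s) (h0 : 0 ≤ p) (hn : p < n) :
    p = s ∧ oR (prim n s p) = .F ∨ p = s / 2 ∧ s % 2 = 1 ∧ oR (prim n s p) = .S ∨
    (p = s / 2 → s % 2 = 0) ∧ p ≠ s ∧ oR (prim n s p) = .n := by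
  rcases h0.eq_or_lt with rfl | h0
  · rcases prim_left (n := n) (s := s) le_rfl with ⟨h, h'⟩ | ⟨h, h'⟩ | ⟨h, h'⟩ <;> rw [h'] <;>
      simp [oR] <;> omega
  · rcases prim_cases (s := s) h0 hn with
      ⟨h, h'⟩ | ⟨h, h1, h'⟩ | ⟨h, h1, h'⟩ | ⟨h, h1, h2, h'⟩ | ⟨h, h1, h2, h'⟩ | ⟨h, h1, h2, h'⟩ |
      ⟨h, h1, h'⟩ <;> rw [h'] <;> simp [oR] <;> omega

theorem oL_prim (h0 : 0 < p) (hn : p ≤ n) :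
    n ≤ s ∧ p = 2 * n - s ∧ oL (prim n s p) = .A ∨
    (n ≤ s → p = 2 * n - s → p ≤ s / 2) ∧ oL (prim n s p) = .n := by
  rcases hn.eq_or_lt with rfl | hn
  · rcases prim_right (n := p) (s := s) h0 le_rfl with ⟨h, h'⟩ | ⟨h, h'⟩ <;> rw [h'] <;>
      simp [oL] <;> omega
  · rcases prim_cases (s := s) h0 hn with
      ⟨h, h'⟩ | ⟨h, h1, h'⟩ | ⟨h, h1, h'⟩ | ⟨h, h1, h2, h'⟩ | ⟨h, h1, h2, h'⟩ | ⟨h, h1, h2, h'⟩ |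
      ⟨h, h1, h'⟩ <;> rw [h'] <;> simp [oL] <;> omega

theorem prim_step (hs : 0 ≤ s) (hm : s + 1 + (s + 1) / 2 < 2 * n) (h0 : 0 < p) (hn : p < n) :
    rule (oR (prim n s (p - 1))) (prim n s p) (oL (prim n s (p + 1))) =
      some (prim n (s + 1) p) := by
  rcases oR_prim (n := n) (p := p - 1) hs (by omega) (by omega) with
    ⟨h1, h1'⟩ | ⟨h1, h1a, h1'⟩ | ⟨h1, h1a, h1'⟩ <;>
  rcases oL_prim (n := n) (s := s) (p := p + 1) (by omega) (by omega) with
    ⟨h2, h2a, h2'⟩ | ⟨h2, h2'⟩ <;>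
  rcases prim_cases (s := s) h0 hn with
      ⟨h, h'⟩ | ⟨h, ha, h'⟩ | ⟨h, ha, h'⟩ | ⟨h, ha, hb, h'⟩ | ⟨h, ha, hb, h'⟩ | ⟨h, ha, hb, h'⟩ |
      ⟨h, ha, h'⟩ <;> try omega
  all_goals
    rcases prim_cases (s := s + 1) h0 hn with
      ⟨h3, h3'⟩ | ⟨h3, h3a, h3'⟩ | ⟨h3, h3a, h3'⟩ | ⟨h3, h3a, h3b, h3'⟩ | ⟨h3, h3a, h3b, h3'⟩ |
      ⟨h3, h3a, h3b, h3'⟩ | ⟨h3, h3a, h3'⟩ <;> try omega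
    all_goals rw [h1', h2', h', h3']; rfl

theorem prim_col (hs : 0 ≤ s) (hm : s + s / 2 < 2 * n) (h0 : 0 ≤ p) (hn : p < n) :
    cR (prim n s p) = cL (prim n s (p + 1)) := by
  have hL : s < 2 ∧ p = 0 ∧ cR (prim n s p) + s = 2 ∨ p < s / 2 ∧ cR (prim n s p) = 0 ∨
      p = s / 2 ∧ 2 ≤ s ∧ cR (prim n s p) = 1 ∨
      s / 2 < p ∧ p < s ∧ p < 2 * n - s ∧ cR (prim n s p) = 1 ∨
      s / 2 < p ∧ (s ≤ p ∨ 2 * n - s ≤ p) ∧ cR (prim n s p) = 2 := by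
    rcases h0.eq_or_lt with rfl | h0
    · rcases prim_left (n := n) (s := s) le_rfl with ⟨h, h'⟩ | ⟨h, h'⟩ | ⟨h, h'⟩ <;> rw [h'] <;>
        simp [cR] <;> omega
    · rcases prim_cases (s := s) h0 hn with
        ⟨h, h'⟩ | ⟨h, h1, h'⟩ | ⟨h, h1, h'⟩ | ⟨h, h1, h2, h'⟩ | ⟨h, h1, h2, h'⟩ |
        ⟨h, h1, h2, h'⟩ | ⟨h, h1, h'⟩ <;> rw [h'] <;> simp [cR] <;> omega
  have hR : p + 1 ≤ s / 2 ∧ cL (prim n s (p + 1)) = 0 ∨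
      s / 2 < p + 1 ∧ p + 1 ≤ s ∧ p + 1 ≤ 2 * n - s ∧ cL (prim n s (p + 1)) = 1 ∨
      s / 2 < p + 1 ∧ (s < p + 1 ∨ 2 * n - s < p + 1) ∧ cL (prim n s (p + 1)) = 2 := by
    rcases (show p + 1 = n ∨ p + 1 < n by omega) with hn' | hn'
    · rcases prim_right (n := n) (s := s) (by omega) hn'.ge with ⟨h, h'⟩ | ⟨h, h'⟩ <;> rw [h'] <;>
        simp [cL] <;> omega
    · rcases prim_cases (s := s) (show 0 < p + 1 by omega) hn' with
        ⟨h, h'⟩ | ⟨h, h1, h'⟩ | ⟨h, h1, h'⟩ | ⟨h, h1, h2, h'⟩ | ⟨h, h1, h2, h'⟩ |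
        ⟨h, h1, h2, h'⟩ | ⟨h, h1, h'⟩ <;> rw [h'] <;> simp [cL] <;> omega
  omega

end Prim

/-- The cell of a wall with state `u` as a right wall and state `v` as a left wall. -/
def merge (u v : Cell) : Cell := if u = V3 then V3 else v

def Compat (u v : Cell) : Prop :=
  u = V3 ∧ v = W ∨ u = W ∧ (v = W ∨ v = V1 ∨ v = WS) ∨ u = v ∧ dead u

/-- Transitions of a left wall with an unspecified left neighbour. -/
def LStep (u : Cell) (q : ML) (u' : Cell) : Prop :=
  rule .n u q = some u' ∨ rule .T u q = some u'

/-- Transitions of a right wall with an unspecified right neighbour. -/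
def RStep (o : MR) (u u' : Cell) : Prop :=
  rule o u .n = some u' ∨ rule o u .X = some u'

instance : DecidableRel Compat := fun u v => by unfold Compat; infer_instance
instance (u q u') : Decidable (LStep u q u') := by unfold LStep; infer_instance
instance (o u u') : Decidable (RStep o u u') := by unfold RStep; infer_instance

theorem merge_step {u v u' v' : Cell} (h : Compat u v) (h' : Compat u' v') {o : MR} {q : ML}
    (ho : RStep o u u') (hq : LStep v q v') : rule o (merge u v) q = some (merge u' v') := by
  have : ∀ u v, Compat u v → ∀ u' v', Compat u' v' → ∀ o, RStep o u u' → ∀ q, LStep v q v' →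
    rule o (merge u v) q = some (merge u' v') := by decide +kernel
  exact this _ _ h _ _ h' _ ho _ hq

theorem Compat.oR_eq {u v : Cell} (h : Compat u v) : oR (merge u v) = oR v := by
  revert u v; decide

theorem Compat.oL_eq {u v : Cell} (h : Compat u v) : oL (merge u v) = oL u := by
  revert u v; decide

theorem Compat.cR_eq {u v : Cell} (h : Compat u v) : cR (merge u v) = cR v := by
  revert u v; decide

theorem Compat.cL_eq {u v : Cell} (h : Compat u v) : cL (merge u v) = cL u := by
  revert u v; decide

/-- `E s p` for `0 ≤ p ≤ n` is the history of an interval of length `n`, from its start at time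
`s = 0` on, whose smallest subinterval created has length `w`. -/
structure Block (w n : ℤ) (E : ℤ → ℤ → Cell) : Prop where
  init : ∀ p, 0 < p → p < n → E 0 p = ga
  initL : E 0 0 = V1
  initR : E 0 n = W
  step : ∀ s p, 0 ≤ s → 0 < p → p < n →
    rule (oR (E s (p - 1))) (E s p) (oL (E s (p + 1))) = some (E (s + 1) p)
  col : ∀ s p, 0 ≤ s → 0 ≤ p → p < n → cR (E s p) = cL (E s (p + 1))
  stepL : ∀ s, 0 ≤ s → LStep (E s 0) (oL (E s 1)) (E (s + 1) 0)
  stepR : ∀ s, 0 ≤ s → RStep (oR (E s (n - 1))) (E s n) (E (s + 1) n)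
  left : ∀ s, 0 ≤ s → s < 6 * n → E s 0 = W ∨ (E s 0 = V1 ∧ (s = 0 ∨ 4 * w ∣ 6 * n - s)) ∨
    (E s 0 = WS ∧ (s = 1 ∨ 4 * w ∣ 6 * n - s + 1))
  leftPost : ∀ s, 6 * n ≤ s → E s 0 = post n s 0
  right : ∀ s, 0 ≤ s → s < 2 * n → E s n = W ∨ E s n = V3 ∧ ∃ k, 2 * n - s = w * (2 * k + 1)
  rightPost : ∀ s, 2 * n ≤ s → E s n = post n s n

theorem dead_post {n s p : ℤ} (h : 6 * n - 4 * p ≤ s) : dead (post n s p) := by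
  rcases post_cases n s p with ⟨h1, h2⟩ | ⟨h1, h2⟩ | ⟨h1, h2⟩ | ⟨h1, h2⟩ | ⟨h1, h2⟩ | ⟨h1, h2⟩
  · omega
  all_goals rw [h2]; rfl

theorem post_shift {n s p n' s' p' : ℤ} (h : s - 6 * n + 4 * p = s' - 6 * n' + 4 * p') :
    post n s p = post n' s' p' := by
  rcases post_cases n s p with ⟨h1, h2⟩ | ⟨h1, h2⟩ | ⟨h1, h2⟩ | ⟨h1, h2⟩ | ⟨h1, h2⟩ | ⟨h1, h2⟩ <;>
  rcases post_cases n' s' p' with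
    ⟨h3, h4⟩ | ⟨h3, h4⟩ | ⟨h3, h4⟩ | ⟨h3, h4⟩ | ⟨h3, h4⟩ | ⟨h3, h4⟩ <;> try omega
  all_goals rw [h2, h4]

/-- A smallest interval. -/
def base (n s p : ℤ) : Cell :=
  if s + s / 2 < 2 * n then prim n s p
  else if p ≤ 0 then (if s < 6 * n then W else post n s p)
  else if n ≤ p then (if s < 2 * n then W else post n s p)
  else if s < 2 * n then
    (if p < s / 2 then be else if p = s / 2 then (if s % 2 = 0 then T0 else T1) else ga)
  else post n s p

section Base

variable {n s p : ℤ}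

theorem base_prim (h : s + s / 2 < 2 * n) : base n s p = prim n s p := by
  rw [base, if_pos h]

theorem base_left (h : 2 * n ≤ s + s / 2) (hs : s < 6 * n) (hp : p ≤ 0) : base n s p = W := by
  rw [base, if_neg (by omega), if_pos hp, if_pos hs]

theorem base_right (h : 2 * n ≤ s + s / 2) (hs : s < 2 * n) (h0 : 0 < p) (hp : n ≤ p) :
    base n s p = W := by
  rw [base, if_neg (by omega), if_neg (by omega), if_pos hp, if_pos hs]

theorem base_post (h0 : 0 ≤ n) (hs : 2 * n ≤ s) (hp : 0 < p ∨ 6 * n ≤ s) :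
    base n s p = post n s p := by
  unfold base
  split_ifs <;> first | rfl | omega

theorem base_mid (h : 2 * n ≤ s + s / 2) (hs : s < 2 * n) (h0 : 0 < p) (hp : p < n) :
    p < s / 2 ∧ base n s p = be ∨ p = s / 2 ∧ s % 2 = 0 ∧ base n s p = T0 ∨
    p = s / 2 ∧ s % 2 = 1 ∧ base n s p = T1 ∨ s / 2 < p ∧ base n s p = ga := by
  unfold base
  rw [if_neg (by omega), if_neg (by omega), if_neg (by omega), if_pos hs]
  split_ifs <;> simp <;> omega

theorem oR_base_mid (h : 2 * n ≤ s + s / 2) (hs : s < 2 * n) (h0 : 0 ≤ p)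
    (hp : p < n) : p = s / 2 ∧ s % 2 = 1 ∧ oR (base n s p) = .T ∨
      (p = s / 2 → s % 2 = 0) ∧ oR (base n s p) = .n := by
  rcases h0.eq_or_lt with rfl | h0
  · rw [base_left h (by omega) le_rfl]
    simp [oR]
    omega
  · rcases base_mid h hs h0 hp with ⟨h1, h'⟩ | ⟨h1, h1', h'⟩ | ⟨h1, h1', h'⟩ | ⟨h1, h'⟩ <;>
      rw [h'] <;> simp [oR] <;> omega

theorem oL_base_mid (h : 2 * n ≤ s + s / 2) (hs : s < 2 * n) (h0 : 0 < p) (hp : p ≤ n) :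
    oL (base n s p) = .n := by
  rcases hp.eq_or_lt with rfl | hp
  · rw [base_right h hs h0 le_rfl]
    rfl
  · rcases base_mid h hs h0 hp with ⟨h1, h'⟩ | ⟨h1, h1', h'⟩ | ⟨h1, h1', h'⟩ | ⟨h1, h'⟩ <;>
      rw [h'] <;> rfl

theorem base_step (h2 : 2 ≤ n) (h3 : n % 3 ≠ 0) (hs : 0 ≤ s) (h0 : 0 < p) (hp : p < n) :
    rule (oR (base n s (p - 1))) (base n s p) (oL (base n s (p + 1))) =
      some (base n (s + 1) p) := by
  by_cases hA : s + 1 + (s + 1) / 2 < 2 * n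
  · rw [base_prim (by omega), base_prim (by omega), base_prim (by omega), base_prim hA]
    exact prim_step hs hA h0 hp
  by_cases hB : s + s / 2 < 2 * n
  · rw [base_prim hB, base_prim hB, base_prim hB]
    rcases oR_prim (n := n) (p := p - 1) hs (by omega) (by omega) with
      ⟨h1, h1'⟩ | ⟨h1, h1a, h1'⟩ | ⟨h1, h1a, h1'⟩ <;>
    rcases oL_prim (n := n) (s := s) (p := p + 1) (by omega) (by omega) with
      ⟨h2, h2a, h2'⟩ | ⟨h2, h2'⟩ <;>
    rcases prim_cases (s := s) h0 hp with
      ⟨h, h'⟩ | ⟨h, ha, h'⟩ | ⟨h, ha, h'⟩ | ⟨h, ha, hb, h'⟩ | ⟨h, ha, hb, h'⟩ | ⟨h, ha, hb, h'⟩ |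
      ⟨h, ha, h'⟩ <;> try omega
    all_goals
      rcases base_mid (n := n) (s := s + 1) (by omega) (by omega) h0 hp with
        ⟨h3, h3'⟩ | ⟨h3, h3a, h3'⟩ | ⟨h3, h3a, h3'⟩ | ⟨h3, h3'⟩ <;> try omega
      all_goals rw [h1', h2', h', h3']; rfl
  by_cases hC : s < 2 * n
  · rw [oL_base_mid (by omega) hC (by omega) (by omega)]
    by_cases hD : s + 1 < 2 * n
    · rcases oR_base_mid (p := p - 1) (by omega) hC (by omega) (by omega) with
        ⟨h1, h1a, h1'⟩ | ⟨h1, h1'⟩ <;>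
      rcases base_mid (by omega) hC h0 hp with
        ⟨h, h'⟩ | ⟨h, ha, h'⟩ | ⟨h, ha, h'⟩ | ⟨h, h'⟩ <;> try omega
      all_goals
        rcases base_mid (n := n) (s := s + 1) (by omega) hD h0 hp with
          ⟨h3, h3'⟩ | ⟨h3, h3a, h3'⟩ | ⟨h3, h3a, h3'⟩ | ⟨h3, h3'⟩ <;> try omega
        all_goals rw [h1', h', h3']; rfl
    · rw [base_post (s := s + 1) (p := p) (by omega) (by omega) (.inl h0)]
      rcases oR_base_mid (p := p - 1) (by omega) hC (by omega) (by omega) with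
        ⟨h1, h1a, h1'⟩ | ⟨h1, h1'⟩ <;>
      rcases base_mid (by omega) hC h0 hp with
        ⟨h, h'⟩ | ⟨h, ha, h'⟩ | ⟨h, ha, h'⟩ | ⟨h, h'⟩ <;> try omega
      all_goals
        rw [h1', h', post, if_pos (by omega)]; rfl
  · have h1 : oR (base n s (p - 1)) = .n := by
      by_cases h : 0 < p - 1 ∨ 6 * n ≤ s
      · rw [base_post (by omega) (by omega) h]
        exact oR_post _ _ _
      · rw [base_left (by omega) (by omega) (by omega)]
        rfl
    rw [h1, base_post (by omega) (by omega) (.inl h0), base_post (by omega) (by omega) (.inl h0),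
      base_post (by omega) (by omega) (.inl (by omega))]
    exact post_step _ _ _

theorem base_col (h2 : 2 ≤ n) (hs : 0 ≤ s) (h0 : 0 ≤ p) (hp : p < n) :
    cR (base n s p) = cL (base n s (p + 1)) := by
  by_cases hB : s + s / 2 < 2 * n
  · rw [base_prim hB, base_prim hB]
    exact prim_col hs hB h0 hp
  by_cases hC : s < 2 * n
  · have hL : p < s / 2 ∧ cR (base n s p) = 0 ∨ s / 2 ≤ p ∧ cR (base n s p) = 2 := by
      rcases h0.eq_or_lt with rfl | h0
      · rw [base_left (by omega) (by omega) le_rfl]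
        left
        exact ⟨by omega, rfl⟩
      · rcases base_mid (by omega) hC h0 hp with
          ⟨h1, h'⟩ | ⟨h1, h1', h'⟩ | ⟨h1, h1', h'⟩ | ⟨h1, h'⟩ <;> rw [h'] <;> simp [cR] <;> omega
    have hR : p + 1 ≤ s / 2 ∧ cL (base n s (p + 1)) = 0 ∨
        s / 2 < p + 1 ∧ cL (base n s (p + 1)) = 2 := by
      rcases (show p + 1 = n ∨ p + 1 < n by omega) with hn | hn
      · rw [base_right (by omega) hC (by omega) (by omega)]
        right
        exact ⟨by omega, rfl⟩
      · rcases base_mid (by omega) hC (show 0 < p + 1 by omega) hn with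
          ⟨h1, h'⟩ | ⟨h1, h1', h'⟩ | ⟨h1, h1', h'⟩ | ⟨h1, h'⟩ <;> rw [h'] <;> simp [cL] <;> omega
    omega
  · rw [base_post (p := p + 1) (by omega) (by omega) (.inl (by omega)), ← post_col]
    by_cases h : 0 < p ∨ 6 * n ≤ s
    · rw [base_post (by omega) (by omega) h]
    · rw [base_left (by omega) (by omega) (by omega), post, if_pos (by omega)]
      rfl

theorem base_stepL (h2 : 2 ≤ n) (hs : 0 ≤ s) :
    LStep (base n s 0) (oL (base n s 1)) (base n (s + 1) 0) := by
  by_cases hB : s + s / 2 < 2 * n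
  · have h1 : oL (base n s 1) = .n := by
      rw [base_prim hB]
      rcases oL_prim (n := n) (s := s) (p := 1) (by omega) (by omega) with
        ⟨h2, h2a, h2'⟩ | ⟨h2, h2'⟩
      · omega
      · exact h2'
    have h3 : s = 0 ∧ base n (s + 1) 0 = WS ∨ 0 < s ∧ base n (s + 1) 0 = W := by
      by_cases hA : s + 1 + (s + 1) / 2 < 2 * n
      · rw [base_prim hA]
        rcases prim_left (n := n) (s := s + 1) (p := 0) le_rfl with ⟨h, h'⟩ | ⟨h, h'⟩ | ⟨h, h'⟩ <;>
          rw [h'] <;> simp <;> omega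
      · rw [base_left (by omega) (by omega) le_rfl]
        right
        exact ⟨by omega, rfl⟩
    rw [h1, base_prim hB]
    rcases prim_left (n := n) (s := s) (p := 0) le_rfl with ⟨h, h'⟩ | ⟨h, h'⟩ | ⟨h, h'⟩ <;>
    rcases h3 with ⟨h3, h3'⟩ | ⟨h3, h3'⟩ <;> try omega
    all_goals rw [h', h3']; decide
  by_cases hC : s < 2 * n
  · rw [oL_base_mid (by omega) hC (by omega) (by omega), base_left (by omega) (by omega) le_rfl,
      base_left (by omega) (by omega) le_rfl]
    decide
  rw [base_post (p := 1) (by omega) (by omega) (.inl (by omega))]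
  by_cases hD : s < 6 * n
  · rw [base_left (by omega) hD le_rfl]
    by_cases hE : s + 1 < 6 * n
    · rw [base_left (by omega) hE le_rfl]
      rcases post_cases n s 1 with ⟨h1, h2⟩ | ⟨h1, h2⟩ | ⟨h1, h2⟩ | ⟨h1, h2⟩ | ⟨h1, h2⟩ | ⟨h1, h2⟩ <;>
        try omega
      all_goals rw [h2]; decide
    · rw [base_post (by omega) (by omega) (.inr (by omega))]
      rcases post_cases n s 1 with ⟨h1, h2⟩ | ⟨h1, h2⟩ | ⟨h1, h2⟩ | ⟨h1, h2⟩ | ⟨h1, h2⟩ | ⟨h1, h2⟩ <;>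
      rcases post_cases n (s + 1) 0 with
        ⟨h3, h4⟩ | ⟨h3, h4⟩ | ⟨h3, h4⟩ | ⟨h3, h4⟩ | ⟨h3, h4⟩ | ⟨h3, h4⟩ <;> try omega
      all_goals rw [h2, h4]; decide
  · rw [base_post (by omega) (by omega) (.inr (by omega)),
      base_post (by omega) (by omega) (.inr (by omega))]
    exact .inl (post_step n s 0)

theorem base_stepR (h2 : 2 ≤ n) (hs : 0 ≤ s) :
    RStep (oR (base n s (n - 1))) (base n s n) (base n (s + 1) n) := by
  by_cases hB : s + s / 2 < 2 * n
  · have h3 : s + 1 = n ∧ base n (s + 1) n = V3 ∨ s + 1 ≠ n ∧ base n (s + 1) n = W := by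
      by_cases hA : s + 1 + (s + 1) / 2 < 2 * n
      · rw [base_prim hA]
        exact prim_right (by omega) le_rfl
      · rw [base_right (by omega) (by omega) (by omega) le_rfl]
        right
        exact ⟨by omega, rfl⟩
    rw [base_prim hB, base_prim hB]
    rcases oR_prim (n := n) (p := n - 1) hs (by omega) (by omega) with
      ⟨h1, h1'⟩ | ⟨h1, h1a, h1'⟩ | ⟨h1, h1a, h1'⟩ <;>
    rcases prim_right (n := n) (s := s) (p := n) (by omega) le_rfl with ⟨h, h'⟩ | ⟨h, h'⟩ <;>
    rcases h3 with ⟨h3, h3'⟩ | ⟨h3, h3'⟩ <;> try omega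
    all_goals rw [h1', h', h3']; decide
  by_cases hC : s < 2 * n
  · rw [base_right (by omega) hC (by omega) le_rfl]
    by_cases hD : s + 1 < 2 * n
    · rw [base_right (by omega) hD (by omega) le_rfl]
      rcases oR_base_mid (p := n - 1) (by omega) hC (by omega) (by omega) with
        ⟨h1, h1a, h1'⟩ | ⟨h1, h1'⟩
      · omega
      · rw [h1']; decide
    · rw [base_post (s := s + 1) (p := n) (by omega) (by omega) (.inl (by omega))]
      rcases oR_base_mid (p := n - 1) (by omega) hC (by omega) (by omega) with
        ⟨h1, h1a, h1'⟩ | ⟨h1, h1'⟩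
      · rw [h1', post, if_neg (by omega), if_pos (by omega)]; decide
      · omega
  · have h1 : oR (base n s (n - 1)) = .n := by
      rw [base_post (by omega) (by omega) (.inl (by omega))]
      exact oR_post _ _ _
    rw [h1, base_post (by omega) (by omega) (.inl (by omega)),
      base_post (by omega) (by omega) (.inl (by omega))]
    rcases post_cases n s n with ⟨h1, h2⟩ | ⟨h1, h2⟩ | ⟨h1, h2⟩ | ⟨h1, h2⟩ | ⟨h1, h2⟩ | ⟨h1, h2⟩ <;>
    rcases post_cases n (s + 1) n with
      ⟨h3, h4⟩ | ⟨h3, h4⟩ | ⟨h3, h4⟩ | ⟨h3, h4⟩ | ⟨h3, h4⟩ | ⟨h3, h4⟩ <;> try omega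
    all_goals rw [h2, h4]; decide

theorem block_base (h2 : 2 ≤ n) (h3 : n % 3 ≠ 0) : Block n n (base n) where
  init p h0 hp := by
    rw [base_prim (by omega)]
    rcases prim_cases (s := 0) h0 hp with
      ⟨h, h'⟩ | ⟨h, ha, h'⟩ | ⟨h, ha, h'⟩ | ⟨h, ha, hb, h'⟩ | ⟨h, ha, hb, h'⟩ | ⟨h, ha, hb, h'⟩ |
      ⟨h, ha, h'⟩ <;> omega
  initL := by
    rw [base_prim (by omega)]
    simp [prim]
  initR := by
    rw [base_prim (by omega)]
    rcases prim_right (n := n) (s := 0) (p := n) (by omega) le_rfl with ⟨h, h'⟩ | ⟨h, h'⟩ <;>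
      omega
  step s p hs h0 hp := base_step h2 h3 hs h0 hp
  col s p hs h0 hp := base_col h2 hs h0 hp
  stepL s hs := base_stepL h2 hs
  stepR s hs := base_stepR h2 hs
  left s hs hs' := by
    by_cases hB : s + s / 2 < 2 * n
    · rw [base_prim hB]
      rcases prim_left (n := n) (s := s) (p := 0) le_rfl with ⟨h, h'⟩ | ⟨h, h'⟩ | ⟨h, h'⟩ <;>
        rw [h'] <;> simp <;> left <;> omega
    · rw [base_left (by omega) hs' le_rfl]
      simp
  leftPost s hs := base_post (by omega) (by omega) (.inr hs)
  right s hs hs' := by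
    by_cases hB : s + s / 2 < 2 * n
    · rw [base_prim hB]
      rcases prim_right (n := n) (s := s) (p := n) (by omega) le_rfl with ⟨h, h'⟩ | ⟨h, h'⟩
      · exact .inr ⟨h', 0, by omega⟩
      · exact .inl h'
    · exact .inl (base_right (by omega) hs' (by omega) le_rfl)
  rightPost s hs := base_post (by omega) hs (.inl (by omega))

end Base

/-- The right wall of the left child of an interval of length `3 * m`. -/
def rightWall (m : ℤ) (L : ℤ → ℤ → Cell) (s : ℤ) : Cell :=
  if s < 6 * m then W else L (s - 6 * m) (2 * m)

/-- An interval of length `3 * m` which is divided into a left child of length `2 * m`, started at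
time `6 * m`, and a right child of length `m`, started at time `4 * m`. -/
def glue (m : ℤ) (L R : ℤ → ℤ → Cell) (s p : ℤ) : Cell :=
  if s < 4 * m then prim (3 * m) s p
  else if p < 2 * m then
    (if s < 6 * m then
      (if p ≤ 0 then W else if p < 6 * m - s then be else if p = 6 * m - s then Gb else ga)
    else L (s - 6 * m) p)
  else if p = 2 * m then
    (if s = 4 * m then V2 else merge (rightWall m L s) (R (s - 4 * m) 0))
  else R (s - 4 * m) (p - 2 * m)

section Glue

variable {w m s p : ℤ} {L R : ℤ → ℤ → Cell}

theorem glue_prim (h : s < 4 * m) : glue m L R s p = prim (3 * m) s p := by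
  rw [glue, if_pos h]

theorem glue_left (h : 6 * m ≤ s) (hm : 0 < m) (hp : p < 2 * m) :
    glue m L R s p = L (s - 6 * m) p := by
  rw [glue, if_neg (by omega), if_pos hp, if_neg (by omega)]

theorem glue_right (h : 4 * m ≤ s) (hp : 2 * m < p) :
    glue m L R s p = R (s - 4 * m) (p - 2 * m) := by
  rw [glue, if_neg (by omega), if_neg (by omega), if_neg (by omega)]

theorem glue_wall (h : 4 * m < s) :
    glue m L R s (2 * m) = merge (rightWall m L s) (R (s - 4 * m) 0) := by
  rw [glue, if_neg (by omega), if_neg (by omega), if_pos rfl, if_neg (by omega)]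

theorem glue_split : glue m L R (4 * m) (2 * m) = V2 := by
  rw [glue, if_neg (by omega), if_neg (by omega), if_pos rfl, if_pos rfl]

theorem glue_wait_left (h : 4 * m ≤ s) (h' : s < 6 * m) (hp : p ≤ 0) : glue m L R s p = W := by
  rw [glue, if_neg (by omega), if_pos (by omega), if_pos h', if_pos hp]

theorem glue_wait (h : 4 * m ≤ s) (h' : s < 6 * m) (h0 : 0 < p) (hp : p < 2 * m) :
    p < 6 * m - s ∧ glue m L R s p = be ∨ p = 6 * m - s ∧ glue m L R s p = Gb ∨
    6 * m - s < p ∧ glue m L R s p = ga := by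
  rw [glue, if_neg (by omega), if_pos hp, if_pos h', if_neg (by omega)]
  split_ifs <;> simp <;> omega

theorem rightWall_wait (h : s < 6 * m) : rightWall m L s = W := if_pos h

theorem rightWall_eq (h : 6 * m ≤ s) : rightWall m L s = L (s - 6 * m) (2 * m) :=
  if_neg (by omega)

theorem compat_rightWall (hL : Block (2 * w) (2 * m) L) (hR : Block w m R) (hw : 0 < w)
    (hs : 4 * m < s) : Compat (rightWall m L s) (R (s - 4 * m) 0) := by
  have h4 {a : ℤ} (k : ℤ) (h : a = 2 * w * (2 * k + 1)) : ¬ 4 * w ∣ a := by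
    rintro ⟨c, hc⟩
    have : w * (2 * k + 1) = w * (2 * c) := by linarith
    have := mul_left_cancel₀ hw.ne' this
    omega
  by_cases h6 : s < 6 * m
  · rw [rightWall_wait h6]
    rcases hR.left (s - 4 * m) (by omega) (by omega) with h | ⟨h, -⟩ | ⟨h, -⟩ <;> rw [h] <;> decide
  rw [rightWall_eq (by omega)]
  by_cases h10 : s < 10 * m
  · rcases hL.right (s - 6 * m) (by omega) (by omega) with h | ⟨h, k, hk⟩ <;>
    rcases hR.left (s - 4 * m) (by omega) (by omega) with h' | ⟨h', h''⟩ | ⟨h', h''⟩ <;>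
    rw [h, h']
    any_goals decide
    · rcases h'' with h'' | h''
      · omega
      · exact absurd h'' (h4 k (by linarith))
    · rcases h'' with h'' | ⟨c, h''⟩
      · omega
      · have h3 : 6 * m - (s - 4 * m) + 1 = 2 * (2 * w * c) := by linarith
        have h5 : 2 * (2 * m) - (s - 6 * m) = 2 * (w * (2 * k + 1)) := by linarith
        omega
  · rw [hL.rightPost _ (by omega), hR.leftPost _ (by omega)]
    exact .inr (.inr ⟨post_shift (by ring), dead_post (by omega)⟩)

theorem oL_glue_wait (hL : Block (2 * w) (2 * m) L) (hR : Block w m R) (hw : 0 < w)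
    (h : 4 * m ≤ s) (h' : s < 6 * m) (h0 : 0 < p) (hp : p ≤ 2 * m) :
    p = 6 * m - s ∧ oL (glue m L R s p) = .B ∨ p ≠ 6 * m - s ∧ oL (glue m L R s p) = .n := by
  rcases hp.eq_or_lt with rfl | hp
  · rcases h.eq_or_lt with rfl | h
    · left
      rw [glue_split]
      exact ⟨by ring, rfl⟩
    · right
      rw [glue_wall h, (compat_rightWall hL hR hw h).oL_eq, rightWall_wait h']
      exact ⟨by omega, rfl⟩
  · rcases glue_wait (L := L) (R := R) h h' h0 hp with ⟨h1, h3⟩ | ⟨h1, h3⟩ | ⟨h1, h3⟩ <;>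
      rw [h3] <;> simp [oL] <;> omega

theorem oR_glue_wait (h : 4 * m ≤ s) (h' : s < 6 * m) (hp : p < 2 * m) :
    oR (glue m L R s p) = .n := by
  rcases le_or_gt p 0 with h0 | h0
  · rw [glue_wait_left h h' h0]
    rfl
  · rcases glue_wait (L := L) (R := R) h h' h0 hp with ⟨h1, h3⟩ | ⟨h1, h3⟩ | ⟨h1, h3⟩ <;>
      rw [h3] <;> rfl

theorem oL_glue_left (hL : Block (2 * w) (2 * m) L) (hR : Block w m R) (hw : 0 < w)
    (h2 : 2 ≤ m) (h : 6 * m ≤ s) (hp : p ≤ 2 * m) :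
    oL (glue m L R s p) = oL (L (s - 6 * m) p) := by
  rcases hp.eq_or_lt with rfl | hp
  · rw [glue_wall (by omega), (compat_rightWall hL hR hw (by omega)).oL_eq, rightWall_eq h]
  · rw [glue_left h (by omega) hp]

theorem cL_glue_left (hL : Block (2 * w) (2 * m) L) (hR : Block w m R) (hw : 0 < w)
    (h2 : 2 ≤ m) (h : 6 * m ≤ s) (hp : p ≤ 2 * m) :
    cL (glue m L R s p) = cL (L (s - 6 * m) p) := by
  rcases hp.eq_or_lt with rfl | hp
  · rw [glue_wall (by omega), (compat_rightWall hL hR hw (by omega)).cL_eq, rightWall_eq h]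
  · rw [glue_left h (by omega) hp]

theorem oR_glue_right (hL : Block (2 * w) (2 * m) L) (hR : Block w m R) (hw : 0 < w)
    (h : 4 * m ≤ s) (hp : 2 * m ≤ p) :
    oR (glue m L R s p) = oR (R (s - 4 * m) (p - 2 * m)) := by
  rcases hp.eq_or_lt with rfl | hp
  · rw [sub_self]
    rcases h.eq_or_lt with rfl | h
    · rw [glue_split, sub_self, hR.initL]
      rfl
    · rw [glue_wall h, (compat_rightWall hL hR hw h).oR_eq]
  · rw [glue_right h hp]

theorem cR_glue_right (hL : Block (2 * w) (2 * m) L) (hR : Block w m R) (hw : 0 < w)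
    (h : 4 * m ≤ s) (hp : 2 * m ≤ p) :
    cR (glue m L R s p) = cR (R (s - 4 * m) (p - 2 * m)) := by
  rcases hp.eq_or_lt with rfl | hp
  · rw [sub_self]
    rcases h.eq_or_lt with rfl | h
    · rw [glue_split, sub_self, hR.initL]
      rfl
    · rw [glue_wall h, (compat_rightWall hL hR hw h).cR_eq]
  · rw [glue_right h hp]

theorem glue_step (hL : Block (2 * w) (2 * m) L) (hR : Block w m R) (hw : 0 < w)
    (h2 : 2 ≤ m) (hs : 0 ≤ s) (h0 : 0 < p) (hp : p < 3 * m) :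
    rule (oR (glue m L R s (p - 1))) (glue m L R s p) (oL (glue m L R s (p + 1))) =
      some (glue m L R (s + 1) p) := by
  by_cases hA : s + 1 < 4 * m
  · rw [glue_prim (by omega), glue_prim (by omega), glue_prim (by omega), glue_prim hA]
    exact prim_step hs (by omega) h0 hp
  by_cases hB : s < 4 * m
  · rw [glue_prim hB, glue_prim hB, glue_prim hB]
    have h3 : p < 2 * m ∧ glue m L R (s + 1) p = be ∨ p = 2 * m ∧ glue m L R (s + 1) p = V2 ∨
        2 * m < p ∧ glue m L R (s + 1) p = ga := by
      rcases lt_trichotomy p (2 * m) with h | h | h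
      · rcases glue_wait (L := L) (R := R) (s := s + 1) (by omega) (by omega) h0 h with
          ⟨h1, h3⟩ | ⟨h1, h3⟩ | ⟨h1, h3⟩
        · exact .inl ⟨h, h3⟩
        · omega
        · omega
      · right; left
        rw [h, show s + 1 = 4 * m by omega]
        exact ⟨rfl, glue_split⟩
      · right; right
        rw [glue_right (by omega) h, show s + 1 - 4 * m = 0 by omega]
        exact ⟨h, hR.init _ (by omega) (by omega)⟩
    rcases oR_prim (n := 3 * m) (p := p - 1) hs (by omega) (by omega) with
      ⟨h1, h1'⟩ | ⟨h1, h1a, h1'⟩ | ⟨h1, h1a, h1'⟩ <;>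
    rcases oL_prim (n := 3 * m) (s := s) (p := p + 1) (by omega) (by omega) with
      ⟨h2, h2a, h2'⟩ | ⟨h2, h2'⟩ <;>
    rcases prim_cases (s := s) h0 hp with
      ⟨h, h'⟩ | ⟨h, ha, h'⟩ | ⟨h, ha, h'⟩ | ⟨h, ha, hb, h'⟩ | ⟨h, ha, hb, h'⟩ | ⟨h, ha, hb, h'⟩ |
      ⟨h, ha, h'⟩ <;> try omega
    all_goals
      rcases h3 with ⟨h3, h3'⟩ | ⟨h3, h3'⟩ | ⟨h3, h3'⟩ <;> try omega
      all_goals rw [h1', h2', h', h3']; rfl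
  rcases lt_trichotomy p (2 * m) with h | rfl | h
  · by_cases hC : s < 6 * m
    · rw [oR_glue_wait (by omega) hC (by omega)]
      have h3 : s + 1 < 6 * m ∧ p < 6 * m - (s + 1) ∧ glue m L R (s + 1) p = be ∨
          s + 1 < 6 * m ∧ p = 6 * m - (s + 1) ∧ glue m L R (s + 1) p = Gb ∨
          6 * m - (s + 1) < p ∧ glue m L R (s + 1) p = ga := by
        by_cases hD : s + 1 < 6 * m
        · rcases glue_wait (L := L) (R := R) (s := s + 1) (by omega) hD h0 h with
            ⟨h1, h3⟩ | ⟨h1, h3⟩ | ⟨h1, h3⟩ <;> simp [h3] <;> omega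
        · right; right
          rw [glue_left (by omega) (by omega) h, show s + 1 - 6 * m = 0 by omega]
          exact ⟨by omega, hL.init _ h0 h⟩
      rcases oL_glue_wait (p := p + 1) hL hR hw (by omega) hC (by omega) (by omega) with
        ⟨h4, h4'⟩ | ⟨h4, h4'⟩ <;>
      rcases glue_wait (L := L) (R := R) (by omega) hC h0 h with
        ⟨h1, h1'⟩ | ⟨h1, h1'⟩ | ⟨h1, h1'⟩ <;>
      rcases h3 with ⟨h3, h3a, h3'⟩ | ⟨h3, h3a, h3'⟩ | ⟨h3, h3'⟩ <;> try omega
      all_goals rw [h1', h3', h4']; rfl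
    · rw [oL_glue_left hL hR hw h2 (by omega) (by omega), glue_left (by omega) (by omega) (by omega),
        glue_left (by omega) (by omega) h, glue_left (by omega) (by omega) h,
        show s + 1 - 6 * m = s - 6 * m + 1 by ring]
      exact hL.step _ _ (by omega) h0 h
  · rw [glue_right (p := 2 * m + 1) (by omega) (by omega), add_sub_cancel_left,
      glue_wall (s := s + 1) (by omega)]
    have hq := hR.stepL (s - 4 * m) (by omega)
    rw [show s - 4 * m + 1 = s + 1 - 4 * m by ring] at hq
    by_cases hC : s = 4 * m
    · have h1 : R (s + 1 - 4 * m) 0 = WS := by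
        rw [show s - 4 * m = 0 by omega, hR.initL, hR.init 1 (by omega) (by omega)] at hq
        revert hq
        generalize R (s + 1 - 4 * m) 0 = c
        revert c
        decide
      rw [h1, rightWall_wait (by omega), oR_glue_wait (by omega) (by omega) (by omega), hC,
        glue_split, sub_self, hR.init 1 (by omega) (by omega)]
      rfl
    · rw [glue_wall (by omega)]
      refine merge_step (compat_rightWall hL hR hw (by omega))
        (compat_rightWall hL hR hw (by omega)) ?_ hq
      by_cases hD : s < 6 * m
      · have h1 : rightWall m L (s + 1) = W := by
          by_cases hE : s + 1 < 6 * m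
          · exact rightWall_wait hE
          · rw [rightWall_eq (by omega), show s + 1 - 6 * m = 0 by omega]
            exact hL.initR
        rw [oR_glue_wait (by omega) hD (by omega), rightWall_wait hD, h1]
        decide
      · rw [glue_left (by omega) (by omega) (by omega), rightWall_eq (by omega),
          rightWall_eq (by omega), show s + 1 - 6 * m = s - 6 * m + 1 by ring]
        exact hL.stepR _ (by omega)
  · rw [oR_glue_right hL hR hw (by omega) (by omega), glue_right (by omega) h,
      glue_right (by omega) h, glue_right (by omega) (by omega),
      show s + 1 - 4 * m = s - 4 * m + 1 by ring, show p - 1 - 2 * m = p - 2 * m - 1 by ring,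
      show p + 1 - 2 * m = p - 2 * m + 1 by ring]
    exact hR.step _ _ (by omega) (by omega) (by omega)

theorem glue_col (hL : Block (2 * w) (2 * m) L) (hR : Block w m R) (hw : 0 < w)
    (h2 : 2 ≤ m) (hs : 0 ≤ s) (h0 : 0 ≤ p) (hp : p < 3 * m) :
    cR (glue m L R s p) = cL (glue m L R s (p + 1)) := by
  by_cases hA : s < 4 * m
  · rw [glue_prim hA, glue_prim hA]
    exact prim_col hs (by omega) h0 hp
  rcases lt_or_ge p (2 * m) with h | h
  · by_cases hC : s < 6 * m
    · have h1 : p < 6 * m - s ∧ cR (glue m L R s p) = 0 ∨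
          6 * m - s ≤ p ∧ cR (glue m L R s p) = 2 := by
        rcases h0.eq_or_lt with rfl | h0
        · rw [glue_wait_left (by omega) hC le_rfl]
          exact .inl ⟨by omega, rfl⟩
        · rcases glue_wait (L := L) (R := R) (by omega) hC h0 h with
            ⟨h1, h3⟩ | ⟨h1, h3⟩ | ⟨h1, h3⟩ <;> rw [h3] <;> simp [cR] <;> omega
      have h3 : p + 1 ≤ 6 * m - s ∧ cL (glue m L R s (p + 1)) = 0 ∨
          6 * m - s < p + 1 ∧ cL (glue m L R s (p + 1)) = 2 := by
        rcases (show p + 1 = 2 * m ∨ p + 1 < 2 * m by omega) with h' | h'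
        · rw [h']
          rcases (show s = 4 * m ∨ 4 * m < s by omega) with h | h
          · rw [h, glue_split]
            exact .inl ⟨by omega, rfl⟩
          · rw [glue_wall h, (compat_rightWall hL hR hw h).cL_eq, rightWall_wait hC]
            exact .inr ⟨by omega, rfl⟩
        · rcases glue_wait (L := L) (R := R) (p := p + 1) (by omega) hC (by omega) h' with
            ⟨h1, h3⟩ | ⟨h1, h3⟩ | ⟨h1, h3⟩ <;> rw [h3] <;> simp [cL] <;> omega
      omega
    · rw [cL_glue_left hL hR hw h2 (by omega) (by omega), glue_left (by omega) (by omega) h]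
      exact hL.col _ _ (by omega) h0 h
  · rw [cR_glue_right hL hR hw (by omega) h, glue_right (by omega) (by omega),
      show p + 1 - 2 * m = p - 2 * m + 1 by ring]
    exact hR.col _ _ (by omega) (by omega) (by omega)

theorem glue_stepL (hL : Block (2 * w) (2 * m) L) (hR : Block w m R) (hw : 0 < w)
    (h2 : 2 ≤ m) (hs : 0 ≤ s) :
    LStep (glue m L R s 0) (oL (glue m L R s 1)) (glue m L R (s + 1) 0) := by
  by_cases hB : s < 4 * m
  · have h1 : oL (glue m L R s 1) = .n := by
      rw [glue_prim hB]
      rcases oL_prim (n := 3 * m) (s := s) (p := 1) (by omega) (by omega) with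
        ⟨h2, h2a, h2'⟩ | ⟨h2, h2'⟩
      · omega
      · exact h2'
    have h3 : s = 0 ∧ glue m L R (s + 1) 0 = WS ∨ 0 < s ∧ glue m L R (s + 1) 0 = W := by
      by_cases hA : s + 1 < 4 * m
      · rw [glue_prim hA]
        rcases prim_left (n := 3 * m) (s := s + 1) (p := 0) le_rfl with
          ⟨h, h'⟩ | ⟨h, h'⟩ | ⟨h, h'⟩ <;> rw [h'] <;> simp <;> omega
      · rw [glue_wait_left (by omega) (by omega) le_rfl]
        exact .inr ⟨by omega, rfl⟩
    rw [h1, glue_prim hB]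
    rcases prim_left (n := 3 * m) (s := s) (p := 0) le_rfl with
      ⟨h, h'⟩ | ⟨h, h'⟩ | ⟨h, h'⟩ <;>
    rcases h3 with ⟨h3, h3'⟩ | ⟨h3, h3'⟩ <;> try omega
    all_goals rw [h', h3']; decide
  by_cases hC : s < 6 * m
  · rw [glue_wait_left (by omega) hC le_rfl]
    have h3 : s + 1 < 6 * m ∧ glue m L R (s + 1) 0 = W ∨
        s + 1 = 6 * m ∧ glue m L R (s + 1) 0 = V1 := by
      by_cases hD : s + 1 < 6 * m
      · exact .inl ⟨hD, glue_wait_left (by omega) hD le_rfl⟩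
      · right
        rw [glue_left (by omega) (by omega) (by omega), show s + 1 - 6 * m = 0 by omega]
        exact ⟨by omega, hL.initL⟩
    rcases oL_glue_wait (p := 1) hL hR hw (by omega) hC (by omega) (by omega) with
      ⟨h4, h4'⟩ | ⟨h4, h4'⟩ <;>
    rcases h3 with ⟨h3, h3'⟩ | ⟨h3, h3'⟩ <;> try omega
    all_goals rw [h4', h3']; decide
  · rw [glue_left (by omega) (by omega) (by omega), glue_left (by omega) (by omega) (by omega),
      glue_left (by omega) (by omega) (by omega), show s + 1 - 6 * m = s - 6 * m + 1 by ring]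
    exact hL.stepL _ (by omega)

theorem glue_stepR (hR : Block w m R) (h2 : 2 ≤ m) (hs : 0 ≤ s) :
    RStep (oR (glue m L R s (3 * m - 1))) (glue m L R s (3 * m)) (glue m L R (s + 1) (3 * m)) := by
  have hm : 3 * m - 2 * m = m := by ring
  by_cases hB : s < 4 * m
  · have h3 : s + 1 = 3 * m ∧ glue m L R (s + 1) (3 * m) = V3 ∨
        s + 1 ≠ 3 * m ∧ glue m L R (s + 1) (3 * m) = W := by
      by_cases hA : s + 1 < 4 * m
      · rw [glue_prim hA]
        exact prim_right (by omega) le_rfl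
      · rw [glue_right (by omega) (by omega), show s + 1 - 4 * m = 0 by omega, hm]
        exact .inr ⟨by omega, hR.initR⟩
    rw [glue_prim hB, glue_prim hB]
    rcases oR_prim (n := 3 * m) (p := 3 * m - 1) hs (by omega) (by omega) with
      ⟨h1, h1'⟩ | ⟨h1, h1a, h1'⟩ | ⟨h1, h1a, h1'⟩ <;>
    rcases prim_right (n := 3 * m) (s := s) (p := 3 * m) (by omega) le_rfl with
      ⟨h, h'⟩ | ⟨h, h'⟩ <;>
    rcases h3 with ⟨h3, h3'⟩ | ⟨h3, h3'⟩ <;> try omega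
    all_goals rw [h1', h', h3']; decide
  · rw [glue_right (by omega) (by omega), glue_right (by omega) (by omega),
      glue_right (by omega) (by omega), show s + 1 - 4 * m = s - 4 * m + 1 by ring, hm,
      show 3 * m - 1 - 2 * m = m - 1 by ring]
    exact hR.stepR _ (by omega)

theorem block_glue (hL : Block (2 * w) (2 * m) L) (hR : Block w m R) (hw : 0 < w)
    (h2 : 2 ≤ m) (hm : ∃ k, m = w * (2 * k + 1)) : Block w (3 * m) (glue m L R) where
  init p h0 hp := by
    rw [glue_prim (by omega)]
    rcases prim_cases (s := 0) h0 hp with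
      ⟨h, h'⟩ | ⟨h, ha, h'⟩ | ⟨h, ha, h'⟩ | ⟨h, ha, hb, h'⟩ | ⟨h, ha, hb, h'⟩ | ⟨h, ha, hb, h'⟩ |
      ⟨h, ha, h'⟩ <;> omega
  initL := by
    rw [glue_prim (by omega)]
    simp [prim]
  initR := by
    rw [glue_prim (by omega)]
    rcases prim_right (n := 3 * m) (s := 0) (p := 3 * m) (by omega) le_rfl with
      ⟨h, h'⟩ | ⟨h, h'⟩ <;> omega
  step s p hs h0 hp := glue_step hL hR hw h2 hs h0 hp
  col s p hs h0 hp := glue_col hL hR hw h2 hs h0 hp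
  stepL s hs := glue_stepL hL hR hw h2 hs
  stepR s hs := glue_stepR hR h2 hs
  left s hs hs' := by
    by_cases hA : s < 4 * m
    · rw [glue_prim hA]
      rcases prim_left (n := 3 * m) (s := s) (p := 0) le_rfl with ⟨h, h'⟩ | ⟨h, h'⟩ | ⟨h, h'⟩ <;>
        rw [h'] <;> simp <;> left <;> omega
    by_cases hB : s < 6 * m
    · rw [glue_wait_left (by omega) hB le_rfl]
      simp
    have h12 : 4 * w ∣ 12 * m := by
      obtain ⟨k, rfl⟩ := hm
      exact ⟨3 * (2 * k + 1), by ring⟩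
    have h8 {a : ℤ} (h : 4 * (2 * w) ∣ a) : 4 * w ∣ a :=
      (Dvd.intro_left 2 (by ring)).trans h
    rw [glue_left (by omega) (by omega) (by omega)]
    rcases hL.left (s - 6 * m) (by omega) (by omega) with h | ⟨h, h1⟩ | ⟨h, h1⟩
    · exact .inl h
    · refine .inr (.inl ⟨h, .inr ?_⟩)
      rcases h1 with h1 | h1
      · rwa [show 6 * (3 * m) - s = 12 * m by omega]
      · rw [show 6 * (3 * m) - s = 6 * (2 * m) - (s - 6 * m) by omega]
        exact h8 h1
    · refine .inr (.inr ⟨h, .inr ?_⟩)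
      rcases h1 with h1 | h1
      · rwa [show 6 * (3 * m) - s + 1 = 12 * m by omega]
      · rw [show 6 * (3 * m) - s + 1 = 6 * (2 * m) - (s - 6 * m) + 1 by omega]
        exact h8 h1
  leftPost s hs := by
    rw [glue_left (by omega) (by omega) (by omega), hL.leftPost _ (by omega)]
    exact post_shift (by ring)
  right s hs hs' := by
    by_cases hA : s < 4 * m
    · rw [glue_prim hA]
      rcases prim_right (n := 3 * m) (s := s) (p := 3 * m) (by omega) le_rfl with
        ⟨h, h'⟩ | ⟨h, h'⟩
      · obtain ⟨k, hk⟩ := hm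
        exact .inr ⟨h', 3 * k + 1, by linarith⟩
      · exact .inl h'
    · rw [glue_right (by omega) (by omega), show 3 * m - 2 * m = m by ring]
      rcases hR.right (s - 4 * m) (by omega) (by omega) with h | ⟨h, k, hk⟩
      · exact .inl h
      · exact .inr ⟨h, k, by linarith⟩
  rightPost s hs := by
    rw [glue_right (by omega) (by omega), show 3 * m - 2 * m = m by ring,
      hR.rightPost _ (by omega)]
    exact post_shift (by ring)

end Glue

/-- The block of length `w * 3 ^ l` with smallest subinterval of length `w`. -/
def nest : ℕ → ℤ → ℤ → ℤ → Cell
  | 0, w => base w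
  | l + 1, w => glue (w * 3 ^ l) (nest l (2 * w)) (nest l w)

theorem block_nest (l : ℕ) {w : ℤ} (h2 : 2 ≤ w) (h3 : w % 3 ≠ 0) :
    Block w (w * 3 ^ l) (nest l w) := by
  induction l generalizing w with
  | zero => simpa [nest] using block_base h2 h3
  | succ l ih =>
    have h := block_glue (w := w) (m := w * 3 ^ l) (L := nest l (2 * w)) (R := nest l w)
      (by simpa [mul_assoc] using ih (w := 2 * w) (by omega) (by omega)) (ih h2 h3) (by omega)
      ?_ ?_
    · rw [pow_succ, ← mul_assoc, mul_comm _ 3]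
      exact h
    · exact h2.trans (le_mul_of_one_le_right (by omega) (one_le_pow₀ (by norm_num)))
    · obtain ⟨k, hk⟩ : Odd ((3 : ℤ) ^ l) := Odd.pow (by decide)
      exact ⟨k, by rw [hk]⟩

/-- A block of length `w * 3 ^ l` and the dying zone on its right. -/
def placed (l : ℕ) (w t p : ℤ) : Cell :=
  if 0 < p then post 0 t p else nest l w (t + 2 * (w * 3 ^ l)) (p + w * 3 ^ l)

/-- The space-time diagram consisting of nested blocks with smallest subintervals of length `w`,
whose common right wall is at position `0`. -/
def diagram (w t p : ℤ) : Cell := placed (t.natAbs + p.natAbs) w t p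

section Diagram

variable {l l' : ℕ} {w t p : ℤ}

theorem three_pow_pos_mul (hw : 0 < w) (l : ℕ) : 0 < w * 3 ^ l :=
  mul_pos hw (by positivity)

theorem mul_three_pow_mono (hw : 0 < w) (h : l ≤ l') : w * 3 ^ l ≤ w * 3 ^ l' :=
  mul_le_mul_of_nonneg_left (pow_le_pow_right₀ (by norm_num) h) hw.le

theorem lt_mul_three_pow (hw : 0 < w) (l : ℕ) : (l : ℤ) < w * 3 ^ l :=
  calc (l : ℤ) < 3 ^ l := by exact_mod_cast l.lt_pow_self (by norm_num)
    _ ≤ w * 3 ^ l := le_mul_of_one_le_left (by positivity) hw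

theorem placed_succ (ht : -(2 * (w * 3 ^ l)) ≤ t) (hp : -(w * 3 ^ l) < p) :
    placed (l + 1) w t p = placed l w t p := by
  unfold placed
  split_ifs with h
  · rfl
  · have h3 : w * 3 ^ (l + 1) = 3 * (w * 3 ^ l) := by ring
    rw [h3, nest, glue_right (by linarith) (by linarith)]
    congr 1 <;> ring

theorem placed_of_le (hw : 0 < w) (ht : -(2 * (w * 3 ^ l)) ≤ t) (hp : -(w * 3 ^ l) < p)
    (h : l ≤ l') : placed l' w t p = placed l w t p := by
  induction h with
  | refl => rfl
  | step h ih =>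
    have := mul_three_pow_mono hw h
    rw [← ih]
    exact placed_succ (by linarith) (by linarith)

theorem diagram_eq (hw : 0 < w) (ht : -(2 * (w * 3 ^ l)) ≤ t) (hp : -(w * 3 ^ l) < p) :
    diagram w t p = placed l w t p := by
  have h := lt_mul_three_pow hw (t.natAbs + p.natAbs)
  push_cast at h
  rw [diagram, ← placed_of_le (l' := max l (t.natAbs + p.natAbs)) hw ht hp (le_max_left _ _)]
  have h1 := neg_abs_le t
  have h2 := neg_abs_le p
  have h3 := abs_nonneg t
  have h4 := abs_nonneg p
  exact (placed_of_le hw (by linarith) (by linarith) (le_max_right _ _)).symm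

theorem exists_placed (hw : 0 < w) (t p : ℤ) : ∃ l : ℕ, -(2 * (w * 3 ^ l)) < t ∧
    -(w * 3 ^ l) < p - 1 := by
  have h := lt_mul_three_pow hw (t.natAbs + p.natAbs + 1)
  push_cast at h
  have h1 := neg_abs_le t
  have h2 := neg_abs_le p
  have h3 := abs_nonneg t
  have h4 := abs_nonneg p
  exact ⟨_, by linarith, by linarith⟩

theorem placed_pos (h : 0 < p) : placed l w t p = post 0 t p := if_pos h

theorem placed_nonpos (h : p ≤ 0) :
    placed l w t p = nest l w (t + 2 * (w * 3 ^ l)) (p + w * 3 ^ l) := if_neg (by omega)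

theorem placed_zero_neg (h2 : 2 ≤ w) (h3 : w % 3 ≠ 0) (ht : -(2 * (w * 3 ^ l)) ≤ t)
    (ht' : t < 0) : placed l w t 0 = W ∨ placed l w t 0 = V3 := by
  rw [placed_nonpos le_rfl, zero_add]
  exact ((block_nest l h2 h3).right _ (by omega) (by omega)).imp_right And.left

theorem placed_zero_nonneg (h2 : 2 ≤ w) (h3 : w % 3 ≠ 0) (ht : 0 ≤ t) :
    placed l w t 0 = post 0 t 0 := by
  have := three_pow_pos_mul (by omega : 0 < w) l
  rw [placed_nonpos le_rfl, zero_add, (block_nest l h2 h3).rightPost _ (by omega)]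
  exact post_shift (by ring)

/-- The rightmost wall of a diagram, as seen from the right. -/
def deathWall (t : ℤ) : Cell := if t < 0 then W else post 0 t 0

theorem lStep_deathWall (t : ℤ) :
    LStep (deathWall t) (oL (post 0 t 1)) (deathWall (t + 1)) := by
  unfold deathWall
  by_cases ht : t < 0
  · rw [if_pos ht]
    rcases post_cases 0 t 1 with ⟨h1, h2⟩ | ⟨h1, h2⟩ | ⟨h1, h2⟩ | ⟨h1, h2⟩ | ⟨h1, h2⟩ | ⟨h1, h2⟩ <;>
      try omega
    all_goals rw [h2]
    · rw [if_pos (by omega)]; decide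
    · rw [if_pos (by omega)]; decide
    · rw [if_pos (by omega)]; decide
    · rw [if_pos (by omega)]; decide
    · rw [if_neg (by omega), show t + 1 = 0 by omega]; decide
  · rw [if_neg ht, if_neg (by omega)]
    exact .inl (post_step 0 t 0)

theorem compat_deathWall (h2 : 2 ≤ w) (h3 : w % 3 ≠ 0) (ht : -(2 * (w * 3 ^ l)) ≤ t) :
    Compat (placed l w t 0) (deathWall t) ∧
      merge (placed l w t 0) (deathWall t) = placed l w t 0 := by
  unfold deathWall
  by_cases h : t < 0
  · rw [if_pos h]
    rcases placed_zero_neg h2 h3 ht h with h | h <;> rw [h] <;> decide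
  · rw [if_neg h, placed_zero_nonneg h2 h3 (by omega)]
    refine ⟨.inr (.inr ⟨rfl, dead_post (by omega)⟩), ?_⟩
    rw [merge]
    split_ifs with h
    · exact h.symm
    · rfl

theorem placed_step (h2 : 2 ≤ w) (h3 : w % 3 ≠ 0) (ht : -(2 * (w * 3 ^ l)) ≤ t)
    (hp : -(w * 3 ^ l) < p) :
    rule (oR (placed l w t (p - 1))) (placed l w t p) (oL (placed l w t (p + 1))) =
      some (placed l w (t + 1) p) := by
  have hb := block_nest l h2 h3
  have hs : t + 1 + 2 * (w * 3 ^ l) = t + 2 * (w * 3 ^ l) + 1 := by ring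
  rcases lt_trichotomy p 0 with h | rfl | h
  · rw [placed_nonpos (by omega), placed_nonpos (by omega), placed_nonpos (by omega),
      placed_nonpos (by omega), hs, show p - 1 + w * 3 ^ l = p + w * 3 ^ l - 1 by ring,
      show p + 1 + w * 3 ^ l = p + w * 3 ^ l + 1 by ring]
    exact hb.step _ _ (by omega) (by omega) (by omega)
  · rw [← (compat_deathWall h2 h3 ht).2, ← (compat_deathWall h2 h3 (t := t + 1) (by omega)).2,
      zero_add, placed_pos (p := 1) (by omega)]
    refine merge_step (compat_deathWall h2 h3 ht).1 (compat_deathWall h2 h3 (by omega)).1 ?_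
      (lStep_deathWall t)
    rw [placed_nonpos (by omega), placed_nonpos le_rfl, placed_nonpos le_rfl, hs,
      show 0 - 1 + w * 3 ^ l = w * 3 ^ l - 1 by ring, zero_add]
    exact hb.stepR _ (by omega)
  · have h1 : oR (placed l w t (p - 1)) = .n := by
      rcases (show p - 1 = 0 ∨ 0 < p - 1 by omega) with h0 | h0
      · rw [h0]
        by_cases h : t < 0
        · rcases placed_zero_neg h2 h3 ht h with h | h <;> rw [h] <;> rfl
        · rw [placed_zero_nonneg h2 h3 (by omega)]
          exact oR_post _ _ _
      · rw [placed_pos h0]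
        exact oR_post _ _ _
    rw [h1, placed_pos h, placed_pos h, placed_pos (by omega)]
    exact post_step _ _ _

theorem placed_col (h2 : 2 ≤ w) (h3 : w % 3 ≠ 0) (ht : -(2 * (w * 3 ^ l)) ≤ t)
    (hp : -(w * 3 ^ l) < p) : cR (placed l w t p) = cL (placed l w t (p + 1)) := by
  rcases lt_trichotomy p 0 with h | rfl | h
  · rw [placed_nonpos h.le, placed_nonpos (by omega),
      show p + 1 + w * 3 ^ l = p + w * 3 ^ l + 1 by ring]
    exact (block_nest l h2 h3).col _ _ (by omega) (by omega) (by omega)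
  · rw [zero_add, placed_pos (p := 1) (by omega)]
    by_cases h : t < 0
    · have h1 : cL (post 0 t 1) = 0 := by
        rcases post_cases 0 t 1 with
          ⟨h1, h2⟩ | ⟨h1, h2⟩ | ⟨h1, h2⟩ | ⟨h1, h2⟩ | ⟨h1, h2⟩ | ⟨h1, h2⟩ <;> try omega
        all_goals rw [h2]; rfl
      rw [h1]
      rcases placed_zero_neg h2 h3 ht h with h | h <;> rw [h] <;> rfl
    · rw [placed_zero_nonneg h2 h3 (by omega)]
      exact post_col _ _ _
  · rw [placed_pos h, placed_pos (by omega)]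
    exact post_col _ _ _

theorem valid_diagram (h2 : 2 ≤ w) (h3 : w % 3 ≠ 0) : Valid (diagram w) where
  step t p := by
    obtain ⟨l, ht, hp⟩ := exists_placed (by omega : 0 < w) t p
    rw [diagram_eq (l := l) (by omega) (by omega) (by omega),
      diagram_eq (l := l) (by omega) (by omega) (by omega),
      diagram_eq (l := l) (by omega) (by omega) (by omega),
      diagram_eq (l := l) (by omega) (by omega) (by omega)]
    exact placed_step h2 h3 (by omega) (by omega)
  col t p := by
    obtain ⟨l, ht, hp⟩ := exists_placed (by omega : 0 < w) t p
    rw [diagram_eq (l := l) (by omega) (by omega) (by omega),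
      diagram_eq (l := l) (by omega) (by omega) (by omega)]
    exact placed_col h2 h3 (by omega) (by omega)

end Diagram

section Chain

variable {l : ℕ} {w n s t p : ℤ}

theorem base_leaf (h2 : 2 ≤ w) (hs : 2 * w ≤ s) :
    (0 < p → base w s p = post w s p) ∧ (s < 6 * w → base w s 0 = W) :=
  ⟨fun h => base_post (by omega) hs (.inl h), fun h => base_left (by omega) h le_rfl⟩

/-- The last phase near the left wall. -/
theorem nest_leaf (l : ℕ) (h2 : 2 ≤ w) (hs : 6 * (w * 3 ^ l) - 4 * (w * 2 ^ l) ≤ s) :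
    (0 < p → p < w * 2 ^ l → nest l w s p = post (w * 3 ^ l) s p) ∧
      (s < 6 * (w * 3 ^ l) → nest l w s 0 = W) := by
  induction l generalizing w s with
  | zero =>
    simp only [pow_zero, mul_one] at hs ⊢
    have := base_leaf (p := p) h2 (s := s) (by omega)
    exact ⟨fun h _ => this.1 h, this.2⟩
  | succ l ih =>
    have h1 : w * 3 ^ (l + 1) = 3 * (w * 3 ^ l) := by ring
    have h4 : w * 2 ^ (l + 1) = 2 * (w * 2 ^ l) := by ring
    have h5 : w * 2 ^ l ≤ w * 3 ^ l :=
      mul_le_mul_of_nonneg_left (pow_le_pow_left₀ (by norm_num) (by norm_num) l) (by omega)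
    have h6 : 0 < w * 2 ^ l := by positivity
    rw [h1, h4] at hs
    rw [h1, h4]
    have h7 : 2 * w * 3 ^ l = 2 * (w * 3 ^ l) := by ring
    have h8 : 2 * w * 2 ^ l = 2 * (w * 2 ^ l) := by ring
    have := ih (w := 2 * w) (s := s - 6 * (w * 3 ^ l)) (by omega) (by rw [h7, h8]; omega)
    rw [h7, h8] at this
    refine ⟨fun h h' => ?_, fun h => ?_⟩
    · rw [nest, glue_left (by omega) (by omega) (by omega), this.1 h h']
      exact post_shift (by ring)
    · rw [nest, glue_left (by omega) (by omega) (by omega), this.2 (by omega)]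

/-- Far from the origin, the diagram for `w` looks like the diagram for `2 * w`. -/
theorem placed_double (h2 : 2 ≤ w) (h3 : w % 3 ≠ 0) (ht : -(w * 2 ^ l) < t)
    (hp : -(w * 2 ^ l) < p) (hp' : p < w * 2 ^ l) :
    placed (l + 1) w (t + 4 * (w * 3 ^ l)) (p - w * 3 ^ l) = placed l (2 * w) t p := by
  have h1 : w * 3 ^ (l + 1) = 3 * (w * 3 ^ l) := by ring
  have h5 : w * 2 ^ l ≤ w * 3 ^ l :=
    mul_le_mul_of_nonneg_left (pow_le_pow_left₀ (by norm_num) (by norm_num) l) (by omega)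
  have h6 : 0 < w * 2 ^ l := by positivity
  have h7 : 2 * w * 3 ^ l = 2 * (w * 3 ^ l) := by ring
  have hR {p : ℤ} := nest_leaf (w := w) (p := p) (s := t + 6 * (w * 3 ^ l)) l h2 (by omega)
  rw [placed_nonpos (by omega), h1,
    show t + 4 * (w * 3 ^ l) + 2 * (3 * (w * 3 ^ l)) = t + 10 * (w * 3 ^ l) by ring,
    show p - w * 3 ^ l + 3 * (w * 3 ^ l) = p + 2 * (w * 3 ^ l) by ring, nest]
  have hs : t + 10 * (w * 3 ^ l) - 6 * (w * 3 ^ l) = t + 2 * (2 * w * 3 ^ l) := by ring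
  have hs' : t + 10 * (w * 3 ^ l) - 4 * (w * 3 ^ l) = t + 6 * (w * 3 ^ l) := by ring
  rcases lt_trichotomy p 0 with h | rfl | h
  · rw [glue_left (by omega) (by omega) (by omega), placed_nonpos h.le, hs, h7]
  · rw [zero_add, glue_wall (by omega), rightWall_eq (by omega), hs, hs', ← h7]
    have h0 := placed_nonpos (l := l) (w := 2 * w) (t := t) le_rfl
    rw [zero_add] at h0
    rw [← h0]
    by_cases ht : t < 0
    · rw [hR (p := 0) |>.2 (by omega)]
      rcases placed_zero_neg (l := l) (w := 2 * w) (t := t) (by omega) (by omega) (by omega) ht with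
        h | h <;> rw [h] <;> rfl
    · rw [(block_nest l h2 h3).leftPost _ (by omega),
        placed_zero_nonneg (w := 2 * w) (by omega) (by omega) (by omega),
        post_shift (n := w * 3 ^ l) (n' := 0) (s' := t) (p' := 0) (by ring)]
      rw [merge]
      split_ifs with h
      · exact h.symm
      · rfl
  · rw [glue_right (by omega) (by omega), hs', add_sub_cancel_right, placed_pos h,
      hR.1 h hp']
    exact post_shift (by ring)

theorem diagram_double (h2 : 2 ≤ w) (h3 : w % 3 ≠ 0) (ht : |t| ≤ l) (hp : |p| ≤ l) :
    diagram w (t + 4 * (w * 3 ^ l)) (p - w * 3 ^ l) = diagram (2 * w) t p := by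
  have h1 : w * 3 ^ (l + 1) = 3 * (w * 3 ^ l) := by ring
  have h4 : (l : ℤ) < w * 2 ^ l :=
    calc (l : ℤ) < 2 ^ l := by exact_mod_cast l.lt_pow_self (by norm_num)
      _ ≤ w * 2 ^ l := le_mul_of_one_le_left (by positivity) (by omega)
  have h5 : w * 2 ^ l ≤ w * 3 ^ l :=
    mul_le_mul_of_nonneg_left (pow_le_pow_left₀ (by norm_num) (by norm_num) l) (by omega)
  have h7 : 2 * w * 3 ^ l = 2 * (w * 3 ^ l) := by ring
  obtain ⟨ht1, ht2⟩ := abs_le.1 ht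
  obtain ⟨hp1, hp2⟩ := abs_le.1 hp
  rw [diagram_eq (l := l + 1) (by omega) (by rw [h1]; omega) (by rw [h1]; omega),
    diagram_eq (l := l) (by omega) (by rw [h7]; omega) (by rw [h7]; omega)]
  exact placed_double h2 h3 (by omega) (by omega) (by omega)

theorem wall_post : wall (post n s p) = false := by
  rcases post_cases n s p with ⟨h1, h2⟩ | ⟨h1, h2⟩ | ⟨h1, h2⟩ | ⟨h1, h2⟩ | ⟨h1, h2⟩ | ⟨h1, h2⟩ <;>
    rw [h2] <;> rfl

theorem wall_prim (h0 : 0 < p) (hp : p < n) : wall (prim n s p) = false := by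
  rcases prim_cases (s := s) h0 hp with
    ⟨h, h'⟩ | ⟨h, ha, h'⟩ | ⟨h, ha, h'⟩ | ⟨h, ha, hb, h'⟩ | ⟨h, ha, hb, h'⟩ | ⟨h, ha, hb, h'⟩ |
    ⟨h, ha, h'⟩ <;> rw [h'] <;> rfl

theorem wall_base (h0 : 0 < p) (hp : p < n) : wall (base n s p) = false := by
  by_cases hB : s + s / 2 < 2 * n
  · rw [base_prim hB]
    exact wall_prim h0 hp
  by_cases hC : s < 2 * n
  · rcases base_mid (by omega) hC h0 hp with
      ⟨h1, h'⟩ | ⟨h1, h1', h'⟩ | ⟨h1, h1', h'⟩ | ⟨h1, h'⟩ <;> rw [h'] <;> rfl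
  · rw [base_post (by omega) (by omega) (.inl h0)]
    exact wall_post

theorem dvd_of_wall_nest (l : ℕ) (hw : 0 < w) (h0 : 0 ≤ p) (hp : p ≤ w * 3 ^ l)
    (h : wall (nest l w s p)) : w ∣ p := by
  induction l generalizing w s p with
  | zero =>
    rw [pow_zero, mul_one] at hp
    rcases h0.eq_or_lt with rfl | h0
    · exact dvd_zero _
    rcases hp.eq_or_lt with rfl | hp
    · exact dvd_rfl
    · rw [nest, wall_base h0 hp] at h
      exact absurd h (by decide)
  | succ l ih =>
    have h1 : w * 3 ^ (l + 1) = 3 * (w * 3 ^ l) := by ring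
    have h4 : w ∣ w * 3 ^ l := dvd_mul_right _ _
    have h7 : 2 * w * 3 ^ l = 2 * (w * 3 ^ l) := by ring
    have hm := three_pow_pos_mul hw l
    rw [h1] at hp
    rw [nest] at h
    rcases h0.eq_or_lt with rfl | h0
    · exact dvd_zero _
    rcases hp.eq_or_lt with rfl | hp
    · exact h4.mul_left 3
    by_cases hA : s < 4 * (w * 3 ^ l)
    · rw [glue_prim hA, wall_prim h0 hp] at h
      exact absurd h (by decide)
    rcases lt_trichotomy p (2 * (w * 3 ^ l)) with hp' | rfl | hp'
    · by_cases hC : s < 6 * (w * 3 ^ l)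
      · rcases glue_wait (L := nest l (2 * w)) (R := nest l w) (by omega) hC h0 hp' with
          ⟨h1, h3⟩ | ⟨h1, h3⟩ | ⟨h1, h3⟩ <;> rw [h3] at h <;> exact absurd h (by decide)
      · rw [glue_left (by omega) hm hp'] at h
        exact (dvd_mul_left w 2).trans (ih (by omega) h0.le (by omega) h)
    · exact h4.mul_left 2
    · rw [glue_right (by omega) hp'] at h
      exact (dvd_sub_left (h4.mul_left 2)).1 (ih hw (by omega) (by omega) h)

theorem dvd_of_wall_diagram (hw : 0 < w) (h : wall (diagram w t p)) : w ∣ p := by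
  obtain ⟨l, ht, hp⟩ := exists_placed hw t p
  rw [diagram_eq (l := l) hw (by omega) (by omega)] at h
  by_cases h0 : 0 < p
  · rw [placed_pos h0, wall_post] at h
    exact absurd h (by decide)
  · rw [placed_nonpos (by omega)] at h
    exact (dvd_add_left (dvd_mul_right _ _)).1 (dvd_of_wall_nest l hw (by omega) (by omega) h)

theorem diagram_split (h2 : 2 ≤ w) :
    diagram w (-2 * w) (-w) = V2 ∧ diagram w (-2 * w) 0 = W := by
  have h1 : w * 3 ^ 1 = 3 * w := by ring
  rw [diagram_eq (l := 1) (by omega) (by omega) (by omega), placed_nonpos (by omega),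
    diagram_eq (l := 1) (by omega) (by omega) (by omega), placed_nonpos (by omega), h1,
    show -2 * w + 2 * (3 * w) = 4 * w by ring, show -w + 3 * w = 2 * w by ring, zero_add]
  simp only [nest, pow_zero, mul_one]
  refine ⟨glue_split, ?_⟩
  rw [glue_right le_rfl (by omega), sub_self, show 3 * w - 2 * w = w by ring, base_prim (by omega),
    prim, if_neg (by omega), if_pos le_rfl, if_neg (by omega)]

/-- The configuration of the diagram for `w`. -/
def conf (w : ℤ) : ℤ × ℤ → Cell := fun m => diagram w (-m.2) m.1

theorem conf_mem (h2 : 2 ≤ w) (h3 : w % 3 ≠ 0) : conf w ∈ shiftSpace := by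
  simpa [shiftSpace, conf] using valid_diagram h2 h3

theorem patLE2_conf (h2 : 2 ≤ w) (h3 : w % 3 ≠ 0) : patLE2 (conf (2 * w)) (conf w) := by
  intro D n
  let l : ℕ := D.sup fun m => (n + m).1.natAbs + (n + m).2.natAbs
  refine ⟨n + (-(w * 3 ^ l), -(4 * (w * 3 ^ l))), fun m hm => ?_⟩
  have hl : (n + m).1.natAbs + (n + m).2.natAbs ≤ l :=
    Finset.le_sup (f := fun m => (n + m).1.natAbs + (n + m).2.natAbs) hm
  rw [Prod.fst_add, Prod.snd_add] at hl
  have := diagram_double (l := l) (t := -(n.2 + m.2)) (p := n.1 + m.1) h2 h3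
    (by rw [abs_neg, Int.abs_eq_natAbs]; omega) (by rw [Int.abs_eq_natAbs]; omega)
  simp only [conf, Prod.fst_add, Prod.snd_add]
  rw [← this]
  congr 1 <;> ring

theorem not_patLE2_conf (h2 : 2 ≤ w) : ¬ patLE2 (conf w) (conf (2 * w)) := by
  intro h
  obtain ⟨n, hn⟩ := h {(-w, 2 * w), (0, 2 * w)} 0
  have hw := diagram_split h2
  have e1 := hn (-w, 2 * w) (by simp)
  have e2 := hn (0, 2 * w) (by simp)
  simp only [conf, Prod.fst_add, Prod.snd_add, zero_add] at e1 e2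
  rw [← neg_mul, hw.1] at e1
  rw [← neg_mul, hw.2] at e2
  have d1 := dvd_of_wall_diagram (w := 2 * w) (by omega) (by rw [e1]; rfl)
  have d2 := dvd_of_wall_diagram (w := 2 * w) (by omega) (by rw [e2]; rfl)
  have := Int.le_of_dvd (by omega) ((dvd_sub d2 d1).trans (by simp : _ ∣ w))
  omega

end Chain

end WallCA

/-- There is a countable two-dimensional SFT, deterministic in some
direction, whose subpattern poset contains an infinite strictly descending chain. -/
theorem exists_countable_SFT_with_infinite_descending_chain :
    ∃ (S : Type) (_ : Fintype S) (X : Set (ℤ × ℤ → S)),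
      IsSFT2 X ∧ X.Countable ∧ DetSomeDir X ∧
      ∃ x : ℕ → ℤ × ℤ → S, (∀ k, x k ∈ X) ∧ ∀ k, patLT2 (x (k + 1)) (x k) := by
  have h2 (k : ℕ) : (2 : ℤ) ≤ 2 ^ (k + 1) := by
    rw [pow_succ]
    exact le_mul_of_one_le_left (by norm_num) (one_le_pow₀ (by norm_num))
  have h3 (k : ℕ) : (2 : ℤ) ^ (k + 1) % 3 ≠ 0 := by
    induction k with
    | zero => decide
    | succ k ih =>
      rw [pow_succ]
      omega
  refine ⟨WallCA.Cell, inferInstance, WallCA.shiftSpace, WallCA.isSFT2_shiftSpace,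
    WallCA.countable_shiftSpace, WallCA.detSomeDir_shiftSpace, fun k => WallCA.conf (2 ^ (k + 1)),
    fun k => WallCA.conf_mem (h2 k) (h3 k), fun k => ?_⟩
  change patLT2 (WallCA.conf (2 ^ (k + 1 + 1))) (WallCA.conf (2 ^ (k + 1)))
  rw [pow_succ' 2 (k + 1)]
  exact ⟨WallCA.patLE2_conf (h2 k) (h3 k), WallCA.not_patLE2_conf (h2 k)⟩
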